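/- arXiv:2507.22011 — 5 statements merged into one kernel-verified Lean document; each statement's English description precedes it below -/
import Mathlib

section
/- Fix reals 𝖳>𝖲>0, 𝖭>0 with 𝖭<𝖳 and parameters q∈(0,1), c>0; for a positive integer L set T=⌊L𝖳⌋, S=⌊L𝖲⌋, N=⌊L𝖭⌋, t=⌊L𝗍⌋, and x=⌊L𝗑⌋+Δx with fixed Δx∈ℤ, where 𝗍_l<𝗍<𝗍_r and (𝗍,𝗑)∈ℋ. Then lim_{L→∞} C_L·( q^{−N+1}(1−q^{N−1})(q^{−T−N}−1) − B̃(x) − D̃(x) ) equals: −1 if 𝗑<(𝖲+𝗍−𝖭)/2; −1 + c^{−1}(1+q)q^{−1−2Δx} if 𝗑=(𝖲+𝗍−𝖭)/2 and along the sequence 2⌊L𝗑⌋=S+t−N; c^{−1}(1+q)q^{−1−2Δx} if (𝖲+𝗍−𝖭)/2<𝗑<(𝖲+𝗍)/2; c(1+q)q^{2Δx+1}/((1+cq^{2Δx})(1+cq^{2Δx+2})) if 𝗑=(𝖲+𝗍)/2 and along the sequence 2⌊L𝗑⌋=S+t; c(1+q)q^{2Δx+1} if (𝖲+𝗍)/2<𝗑<(𝖲+𝗍+𝖭)/2;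 −1 + c(1+q)q^{2Δx+1} if 𝗑=(𝖲+𝗍+𝖭)/2 and along the sequence 2⌊L𝗑⌋=S+t+N; and −1 if 𝗑>(𝖲+𝗍+𝖭)/2. -/
open Filter

/-- The coefficient `B̃(x)` of the q-Racah difference operator on the `t`-th slice
(uniform in all four parameter zones, with `c = −κ²`). -/
noncomputable def Bcoef (q c : ℝ) (T S N t x : ℤ) : ℝ :=
  q ^ (-2 * N - T) * (q ^ T + c * q ^ (x + 1)) * (q ^ (N + S) - q ^ (x + 1)) *
      (q ^ (N + t) - q ^ (x + 1)) * (q ^ (S + t) + c * q ^ (x + 1)) /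
    ((q ^ (S + t) + c * q ^ (2 * x + 1)) * (q ^ (S + t) + c * q ^ (2 * x + 2)))

/-- The coefficient `D̃(x)` of the q-Racah difference operator on the `t`-th slice. -/
noncomputable def Dcoef (q c : ℝ) (T S N t x : ℤ) : ℝ :=
  q ^ (-2 * N - T + 1) * (1 - q ^ x) * (q ^ S + c * q ^ (N + x)) *
      (q ^ t + c * q ^ (N + x)) * (q ^ (S + t) - q ^ (T + x)) /
    ((q ^ (S + t) + c * q ^ (2 * x)) * (q ^ (S + t) + c * q ^ (2 * x + 1)))

/-- The scaling prefactor `C_L = q^{N+T+max(N−|2X−S−t|,0)}` where `X = ⌊L𝗑⌋`. -/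
noncomputable def Cpre (q : ℝ) (T S N t X : ℤ) : ℝ :=
  q ^ (N + T + max (N - |2 * X - S - t|) 0)

/-- The scaled diagonal coefficient
`C_L·(q^{−N+1}(1−q^{N−1})(q^{−T−N}−1) − B̃(x) − D̃(x))` at
`x = ⌊L𝗑⌋ + Δx` with `T = ⌊L𝖳⌋, S = ⌊L𝖲⌋, N = ⌊L𝖭⌋, t = ⌊L𝗍⌋`. -/
noncomputable def diagScaled (q c sT sS sN st sx : ℝ) (Δx : ℤ) (L : ℕ) : ℝ :=
  Cpre q ⌊(L : ℝ) * sT⌋ ⌊(L : ℝ) * sS⌋ ⌊(L : ℝ) * sN⌋ ⌊(L : ℝ) * st⌋ ⌊(L : ℝ) * sx⌋ *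
    (q ^ (-⌊(L : ℝ) * sN⌋ + 1) * (1 - q ^ (⌊(L : ℝ) * sN⌋ - 1)) *
        (q ^ (-⌊(L : ℝ) * sT⌋ - ⌊(L : ℝ) * sN⌋) - 1)
      - Bcoef q c ⌊(L : ℝ) * sT⌋ ⌊(L : ℝ) * sS⌋ ⌊(L : ℝ) * sN⌋ ⌊(L : ℝ) * st⌋
          (⌊(L : ℝ) * sx⌋ + Δx)
      - Dcoef q c ⌊(L : ℝ) * sT⌋ ⌊(L : ℝ) * sS⌋ ⌊(L : ℝ) * sN⌋ ⌊(L : ℝ) * st⌋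
          (⌊(L : ℝ) * sx⌋ + Δx))

/-- `(𝗍,𝗑)` lies in the scaled hexagon `ℋ`. -/
def inHex (sT sS sN st sx : ℝ) : Prop :=
  0 < st ∧ st < sT ∧ max 0 (st - sT + sS) < sx ∧ sx < min (sS + sN) (st + sN)

/-- The integer sequence `e` grows linearly with asymptotic slope `r`. -/
def HasRate (e : ℕ → ℤ) (r : ℝ) : Prop :=
  Tendsto (fun L : ℕ => (e L : ℝ) / L) atTop (nhds r)

namespace HasRate

variable {e f : ℕ → ℤ} {r r' : ℝ}

theorem floor (r : ℝ) : HasRate (fun L => ⌊(L : ℝ) * r⌋) r := by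
  unfold HasRate
  have h0 : Tendsto (fun L : ℕ => r - 1 / (L : ℝ)) atTop (nhds r) := by
    simpa using (tendsto_const_nhds (x := r)).sub tendsto_one_div_atTop_nhds_zero_nat
  refine tendsto_of_tendsto_of_tendsto_of_le_of_le' h0 tendsto_const_nhds ?_ ?_ <;>
    filter_upwards [eventually_gt_atTop 0] with L hL <;>
    have hL' : (0 : ℝ) < L := by exact_mod_cast hL
  · rw [le_div_iff₀ hL', sub_mul, one_div_mul_cancel hL'.ne', mul_comm]
    exact (Int.sub_one_lt_floor _).le
  · rw [div_le_iff₀ hL', mul_comm r]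
    exact Int.floor_le _

theorem const (k : ℤ) : HasRate (fun _ => k) 0 := by
  unfold HasRate
  exact tendsto_const_nhds.div_atTop tendsto_natCast_atTop_atTop

theorem add (he : HasRate e r) (hf : HasRate f r') :
    HasRate (fun L => e L + f L) (r + r') := by
  unfold HasRate at *
  simpa [add_div] using Tendsto.add he hf

theorem neg (he : HasRate e r) : HasRate (fun L => -e L) (-r) := by
  unfold HasRate at *
  simpa [neg_div] using Tendsto.neg he

theorem sub (he : HasRate e r) (hf : HasRate f r') :
    HasRate (fun L => e L - f L) (r - r') := by
  simpa [sub_eq_add_neg] using he.add hf.neg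

theorem const_mul (k : ℤ) (he : HasRate e r) : HasRate (fun L => k * e L) (k * r) := by
  unfold HasRate at *
  simpa [mul_div_assoc] using Tendsto.const_mul (k : ℝ) he

theorem abs (he : HasRate e r) : HasRate (fun L => |e L|) |r| := by
  unfold HasRate at *
  simpa [abs_div] using Tendsto.abs he

theorem max (he : HasRate e r) (hf : HasRate f r') :
    HasRate (fun L => max (e L) (f L)) (max r r') := by
  unfold HasRate at *
  refine (Tendsto.max he hf).congr fun L => ?_
  rw [Int.cast_max, max_div_div_right (Nat.cast_nonneg L)]

theorem tendsto_cast_atTop (he : HasRate e r) (hr : 0 < r) :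
    Tendsto (fun L => (e L : ℝ)) atTop atTop := by
  refine (Tendsto.pos_mul_atTop hr he tendsto_natCast_atTop_atTop).congr' ?_
  filter_upwards [eventually_ne_atTop 0] with L hL
  have : (L : ℝ) ≠ 0 := by exact_mod_cast hL
  field_simp

theorem eventually_pos (he : HasRate e r) (hr : 0 < r) : ∀ᶠ L in atTop, 0 < e L := by
  filter_upwards [(he.tendsto_cast_atTop hr).eventually_gt_atTop 0] with L hL
  exact_mod_cast hL

theorem tendsto_zpow_zero (he : HasRate e r) (hr : 0 < r) {q : ℝ} (hq0 : 0 < q) (hq1 : q < 1) :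
    Tendsto (fun L => q ^ e L) atTop (nhds 0) := by
  refine ((tendsto_rpow_atTop_of_base_lt_one q (by linarith) hq1).comp
    (he.tendsto_cast_atTop hr)).congr fun L => ?_
  simp [Real.rpow_intCast]

end HasRate

/-- Common factor of the two odd terms in the numerator of the diagonal coefficient, in the
variables `a = q^T`, `s = q^S`, `n = q^N`, `τ = q^t`. -/
def oddFactor (c a s n τ : ℝ) : ℝ :=
  (a + s * τ) * (c * n ^ 2 - 1) + n * (s + τ) * (c - a)

/-- The leading profile, as a function of `u = q^{2x-S-t}`. -/
noncomputable def profile (q c u : ℝ) : ℝ :=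
  q * (1 + q) * c * u / ((1 + c * u) * (1 + c * q ^ 2 * u))

/-- Relative correction to the leading profile. -/
noncomputable def profileCorrection (c a s n τ : ℝ) : ℝ :=
  a * n ^ 2 - c * n ^ 2 + n * (s + τ) * (a + s * τ) / (s * τ) - a / c

/-- Partial fraction form of the scaled diagonal coefficient: the apparent pole of `B̃ + D̃` at
`q^{S+t} + c q^{2x+1} = 0` cancels. -/
theorem diag_partial_fractions {q c a s n τ X : ℝ} (hq : 0 < q) (hc : 0 < c) (ha : 0 < a)
    (hs : 0 < s) (hn : 0 < n) (hτ : 0 < τ) (hX : 0 < X) (m : ℝ) :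
    n * a * m * (q / n * (1 - n / q) * (1 / (a * n) - 1)
      - (a + c * (X * q)) * (n * s - X * q) * (n * τ - X * q) * (s * τ + c * (X * q)) /
          (n ^ 2 * a * ((s * τ + c * (X ^ 2 * q)) * (s * τ + c * (X ^ 2 * q ^ 2))))
      - q * (1 - X) * (s + c * (n * X)) * (τ + c * (n * X)) * (s * τ - a * X) /
          (n ^ 2 * a * ((s * τ + c * X ^ 2) * (s * τ + c * (X ^ 2 * q)))))
    = -m + m / n * profile q c (X ^ 2 / (s * τ))
      + (-(m * q * a)
        + m * q * oddFactor c a s n τ * X * (c * q * X ^ 2 - s * τ) /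
            (n * ((s * τ + c * X ^ 2) * (s * τ + c * q ^ 2 * X ^ 2)))
        + m / n * profile q c (X ^ 2 / (s * τ)) * profileCorrection c a s n τ) := by
  have hu : profile q c (X ^ 2 / (s * τ)) =
      q * (1 + q) * c * (s * τ) * X ^ 2 /
        ((s * τ + c * X ^ 2) * (s * τ + c * q ^ 2 * X ^ 2)) := by
    unfold profile
    field_simp
  rw [hu]
  unfold oddFactor profileCorrection
  have h0 : s * τ + c * X ^ 2 ≠ 0 := by positivity
  have h1 : s * τ + c * (X ^ 2 * q) ≠ 0 := by positivity
  have h2 : s * τ + c * q ^ 2 * X ^ 2 ≠ 0 := by positivity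
  have h3 : s * τ + c * (X ^ 2 * q ^ 2) = s * τ + c * q ^ 2 * X ^ 2 := by ring
  rw [h3]
  field_simp
  ring

theorem oddFactor_abs_le {c a s n τ : ℝ} (hc : 0 < c) (ha : 0 < a) (ha1 : a ≤ 1)
    (hs : 0 < s) (hn : 0 < n) (hn1 : n ≤ 1) (hτ : 0 < τ) :
    |oddFactor c a s n τ| ≤ (c + 1) * (a + s * τ + n * s + n * τ) := by
  unfold oddFactor
  have hn2 : n ^ 2 ≤ 1 := pow_le_one₀ hn.le hn1
  have h1 : |c * n ^ 2 - 1| ≤ c + 1 := by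
    rw [abs_le]
    constructor <;> nlinarith [sq_nonneg n]
  have h2 : |c - a| ≤ c + 1 := by
    rw [abs_le]
    constructor <;> linarith
  calc _ ≤ |(a + s * τ) * (c * n ^ 2 - 1)| + |n * (s + τ) * (c - a)| := abs_add_le _ _
    _ = (a + s * τ) * |c * n ^ 2 - 1| + n * (s + τ) * |c - a| := by
      rw [abs_mul, abs_mul, abs_of_pos (by positivity : 0 < a + s * τ),
        abs_of_pos (by positivity : 0 < n * (s + τ))]
    _ ≤ (a + s * τ) * (c + 1) + n * (s + τ) * (c + 1) := by gcongr
    _ = _ := by ring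

theorem odd_term_abs_le {q c p X : ℝ} (hq : 0 < q) (hq1 : q < 1) (hc : 0 < c) (hp : 0 < p)
    (hX : 0 < X) :
    |q * X * (c * q * X ^ 2 - p) / ((p + c * X ^ 2) * (p + c * q ^ 2 * X ^ 2))| ≤
      X / (p + c * X ^ 2) := by
  have h : |q * (c * q * X ^ 2 - p)| ≤ p + c * q ^ 2 * X ^ 2 := by
    rw [abs_le]
    constructor
    · nlinarith [mul_pos hc (pow_pos hX 2), mul_pos (mul_pos hc (pow_pos hq 2)) (pow_pos hX 2)]
    · nlinarith
  rw [abs_div, abs_of_pos (by positivity : 0 < (p + c * X ^ 2) * (p + c * q ^ 2 * X ^ 2)),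
    show q * X * (c * q * X ^ 2 - p) = X * (q * (c * q * X ^ 2 - p)) by ring, abs_mul,
    abs_of_pos hX, div_le_div_iff₀ (by positivity) (by positivity)]
  calc X * |q * (c * q * X ^ 2 - p)| * (p + c * X ^ 2)
      ≤ X * (p + c * q ^ 2 * X ^ 2) * (p + c * X ^ 2) := by gcongr
    _ = _ := by ring

theorem div_add_mul_sq_le_zpow {q c : ℝ} (hq : 0 < q) (hc : 0 < c) (w x : ℤ) :
    q ^ x / (q ^ w + c * (q ^ x) ^ 2) ≤ (1 + c⁻¹) * q ^ max (x - w) (-x) := by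
  have hx : 0 < q ^ x := zpow_pos hq _
  have hw : 0 < q ^ w := zpow_pos hq _
  have hci : 0 < c⁻¹ := inv_pos.mpr hc
  rcases max_choice (x - w) (-x) with h | h <;> rw [h]
  · rw [zpow_sub₀ hq.ne']
    calc q ^ x / (q ^ w + c * (q ^ x) ^ 2) ≤ q ^ x / q ^ w := by
          gcongr
          have : 0 < c * (q ^ x) ^ 2 := by positivity
          linarith
      _ ≤ (1 + c⁻¹) * (q ^ x / q ^ w) :=
          le_mul_of_one_le_left (by positivity) (by linarith)
  · rw [zpow_neg]
    calc q ^ x / (q ^ w + c * (q ^ x) ^ 2) ≤ q ^ x / (c * (q ^ x) ^ 2) := by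
          gcongr
          linarith
      _ = c⁻¹ * (q ^ x)⁻¹ := by field_simp
      _ ≤ (1 + c⁻¹) * (q ^ x)⁻¹ := by
          gcongr
          linarith

theorem profile_nonneg {q c u : ℝ} (hq : 0 < q) (hc : 0 < c) (hu : 0 < u) :
    0 ≤ profile q c u := by
  unfold profile
  positivity

theorem profile_le_mul {q c u : ℝ} (hq : 0 < q) (hc : 0 < c) (hu : 0 < u) :
    profile q c u ≤ q * (1 + q) * c * u := by
  unfold profile
  apply div_le_self (by positivity)
  have h1 : 0 < c * u := by positivity
  have h2 : 0 < c * q ^ 2 * u := by positivity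
  nlinarith [mul_pos h1 h2]

theorem profile_eq_inv {q c u : ℝ} (hu : 0 < u) :
    profile q c u = q * (1 + q) * c * u⁻¹ / ((u⁻¹ + c) * (u⁻¹ + c * q ^ 2)) := by
  unfold profile
  have h1 : 1 + c * u = u * (u⁻¹ + c) := by field_simp
  have h2 : 1 + c * q ^ 2 * u = u * (u⁻¹ + c * q ^ 2) := by field_simp
  rw [h1, h2]
  field_simp

theorem profile_le_mul_inv {q c u : ℝ} (hq : 0 < q) (hc : 0 < c) (hu : 0 < u) :
    profile q c u ≤ (1 + q) / (q * c) * u⁻¹ := by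
  rw [profile_eq_inv hu]
  have hv : 0 < u⁻¹ := inv_pos.mpr hu
  calc _ ≤ q * (1 + q) * c * u⁻¹ / (c * (c * q ^ 2)) := by
        gcongr <;> linarith
    _ = _ := by field_simp

/-- The leading term is bounded as soon as the prefactor `q^k` satisfies `k ≥ -|d|`. -/
theorem zpow_mul_profile_le {q c : ℝ} (hq : 0 < q) (hq1 : q < 1) (hc : 0 < c) (δ : ℤ) {k d : ℤ}
    (hk : -|d| ≤ k) :
    q ^ k * profile q c (q ^ (δ + d)) ≤
      q * (1 + q) * c * q ^ δ + (1 + q) / (q * c) * q ^ (-δ) := by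
  have hkd : q ^ k ≤ q ^ (-|d|) := zpow_le_zpow_right_of_le_one₀ hq hq1.le hk
  have hδ : 0 < q ^ δ := zpow_pos hq _
  have hδ' : 0 < q ^ (-δ) := zpow_pos hq _
  have hu : 0 < q ^ (δ + d) := zpow_pos hq _
  have hP := profile_nonneg hq hc hu
  rcases abs_choice d with h | h <;> rw [h] at hkd
  · calc _ ≤ q ^ (-d) * (q * (1 + q) * c * q ^ (δ + d)) := by
          gcongr
          exact profile_le_mul hq hc hu
      _ = q * (1 + q) * c * (q ^ (-d) * q ^ (δ + d)) := by ring
      _ = q * (1 + q) * c * q ^ δ := by rw [← zpow_add₀ hq.ne']; congr 2; ring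
      _ ≤ _ := le_add_of_nonneg_right (by positivity)
  · calc _ ≤ q ^ (- -d) * ((1 + q) / (q * c) * (q ^ (δ + d))⁻¹) := by
          gcongr
          exact profile_le_mul_inv hq hc hu
      _ = (1 + q) / (q * c) * (q ^ (- -d) * q ^ (-(δ + d))) := by rw [zpow_neg q (δ + d)]; ring
      _ = (1 + q) / (q * c) * q ^ (-δ) := by rw [← zpow_add₀ hq.ne']; congr 2; ring
      _ ≤ _ := le_add_of_nonneg_left (by positivity)

/-- Difference between the scaled diagonal coefficient and its leading part. -/
noncomputable def diagError (q c : ℝ) (T S N t M x : ℤ) : ℝ :=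
  -(q ^ M * q * q ^ T)
    + q ^ M * q * oddFactor c (q ^ T) (q ^ S) (q ^ N) (q ^ t) * q ^ x *
        (c * q * (q ^ x) ^ 2 - q ^ S * q ^ t) /
        (q ^ N * ((q ^ S * q ^ t + c * (q ^ x) ^ 2) * (q ^ S * q ^ t + c * q ^ 2 * (q ^ x) ^ 2)))
    + q ^ (M - N) * profile q c (q ^ (2 * x - S - t)) *
        profileCorrection c (q ^ T) (q ^ S) (q ^ N) (q ^ t)

theorem diag_eq_leading_add_error {q c : ℝ} (hq : 0 < q) (hc : 0 < c) (T S N t M x : ℤ) :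
    q ^ (N + T + M) * (q ^ (-N + 1) * (1 - q ^ (N - 1)) * (q ^ (-T - N) - 1)
      - Bcoef q c T S N t x - Dcoef q c T S N t x)
    = -q ^ M + q ^ (M - N) * profile q c (q ^ (2 * x - S - t)) + diagError q c T S N t M x := by
  have hq' := hq.ne'
  have h := diag_partial_fractions hq hc (zpow_pos hq T) (zpow_pos hq S) (zpow_pos hq N)
    (zpow_pos hq t) (zpow_pos hq x) (q ^ M)
  have hu : q ^ (2 * x - S - t) = (q ^ x) ^ 2 / (q ^ S * q ^ t) := by
    rw [sub_sub, zpow_sub₀ hq', zpow_add₀ hq', mul_comm 2 x, zpow_mul]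
    norm_cast
  have hx2 : q ^ (2 * x) = (q ^ x) ^ 2 := by
    rw [mul_comm 2 x, zpow_mul]
    norm_cast
  have hN2 : q ^ (-2 * N) = ((q ^ N) ^ 2)⁻¹ := by
    rw [mul_comm (-2) N, zpow_mul, zpow_neg]
    norm_cast
  have hN1 : q ^ (-N + 1) = q / q ^ N := by
    rw [zpow_add₀ hq', zpow_neg, zpow_one]
    ring
  have hTN : q ^ (-T - N) = 1 / (q ^ T * q ^ N) := by
    rw [zpow_sub₀ hq', zpow_neg]
    field_simp
  have hB : Bcoef q c T S N t x =
      (q ^ T + c * (q ^ x * q)) * (q ^ N * q ^ S - q ^ x * q) * (q ^ N * q ^ t - q ^ x * q) *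
        (q ^ S * q ^ t + c * (q ^ x * q)) /
        ((q ^ N) ^ 2 * q ^ T * ((q ^ S * q ^ t + c * ((q ^ x) ^ 2 * q)) *
          (q ^ S * q ^ t + c * ((q ^ x) ^ 2 * q ^ 2)))) := by
    unfold Bcoef
    rw [zpow_sub₀ hq', hN2]
    simp only [zpow_add₀ hq', hx2, zpow_ofNat]
    field_simp
  have hD : Dcoef q c T S N t x =
      q * (1 - q ^ x) * (q ^ S + c * (q ^ N * q ^ x)) * (q ^ t + c * (q ^ N * q ^ x)) *
        (q ^ S * q ^ t - q ^ T * q ^ x) /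
        ((q ^ N) ^ 2 * q ^ T * ((q ^ S * q ^ t + c * (q ^ x) ^ 2) *
          (q ^ S * q ^ t + c * ((q ^ x) ^ 2 * q)))) := by
    unfold Dcoef
    rw [zpow_add₀ hq', zpow_sub₀ hq', hN2]
    simp only [zpow_add₀ hq', hx2, zpow_one]
    field_simp
  unfold diagError
  rw [hB, hD, hu, hN1, hTN, zpow_sub_one₀ hq', zpow_sub₀ hq', zpow_add₀ hq', zpow_add₀ hq',
    ← div_eq_mul_inv]
  exact h

theorem diagError_abs_le {q c : ℝ} (hq : 0 < q) (hq1 : q < 1) (hc : 0 < c) {T N M : ℤ}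
    (S t x : ℤ) (hT : 0 ≤ T) (hN : 0 ≤ N) (hM : 0 ≤ M) :
    |diagError q c T S N t M x| ≤ q ^ T
      + (1 + c⁻¹) * (c + 1) * (q ^ (M - N + max (x - (S + t)) (-x) + T)
          + q ^ (M - N + max (x - (S + t)) (-x) + (S + t))
          + q ^ (M - N + max (x - (S + t)) (-x) + (N + S))
          + q ^ (M - N + max (x - (S + t)) (-x) + (N + t)))
      + q ^ (M - N) * profile q c (q ^ (2 * x - S - t)) *
        |profileCorrection c (q ^ T) (q ^ S) (q ^ N) (q ^ t)| := by
  have hq' := hq.ne'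
  have pos : ∀ k : ℤ, 0 < q ^ k := fun k => zpow_pos hq k
  have le1 : ∀ {k : ℤ}, 0 ≤ k → q ^ k ≤ 1 := fun hk => by
    simpa using zpow_le_zpow_right_of_le_one₀ hq hq1.le hk
  unfold diagError
  refine (abs_add_three _ _ _).trans ?_
  gcongr ?_ + ?_ + ?_
  · rw [abs_neg, abs_of_pos (mul_pos (mul_pos (pos M) hq) (pos T))]
    have : q ^ M * q ≤ 1 := mul_le_one₀ (le1 hM) hq.le hq1.le
    exact mul_le_of_le_one_left (pos T).le this
  · have hK := oddFactor_abs_le hc (pos T) (le1 hT) (pos S) (pos N) (le1 hN) (pos t)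
    have hW := odd_term_abs_le hq hq1 hc (mul_pos (pos S) (pos t)) (pos x)
    have hw := div_add_mul_sq_le_zpow hq hc (S + t) x
    rw [zpow_add₀ hq'] at hw
    rw [show q ^ M * q * oddFactor c (q ^ T) (q ^ S) (q ^ N) (q ^ t) * q ^ x *
        (c * q * (q ^ x) ^ 2 - q ^ S * q ^ t) /
        (q ^ N * ((q ^ S * q ^ t + c * (q ^ x) ^ 2) * (q ^ S * q ^ t + c * q ^ 2 * (q ^ x) ^ 2)))
      = q ^ (M - N) * oddFactor c (q ^ T) (q ^ S) (q ^ N) (q ^ t) *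
        (q * q ^ x * (c * q * (q ^ x) ^ 2 - q ^ S * q ^ t) /
          ((q ^ S * q ^ t + c * (q ^ x) ^ 2) * (q ^ S * q ^ t + c * q ^ 2 * (q ^ x) ^ 2))) by
      rw [zpow_sub₀ hq']
      field_simp, abs_mul, abs_mul, abs_of_pos (pos (M - N))]
    calc _ ≤ q ^ (M - N) * ((c + 1) * (q ^ T + q ^ S * q ^ t + q ^ N * q ^ S + q ^ N * q ^ t)) *
          ((1 + c⁻¹) * q ^ max (x - (S + t)) (-x)) := by
          have := pos (M - N)
          gcongr
          exact hW.trans hw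
      _ = _ := by
          simp only [zpow_add₀ hq']
          ring
  · rw [abs_mul, abs_of_nonneg (mul_nonneg (pos _).le (profile_nonneg hq hc (pos _)))]

theorem profileCorrection_tendsto {q c : ℝ} (hq : 0 < q) (hq1 : q < 1) {T S N t : ℕ → ℤ}
    {sT sS sN st : ℝ} (hT : HasRate T sT) (hS : HasRate S sS) (hN : HasRate N sN)
    (ht : HasRate t st) (hT0 : 0 < sT) (hN0 : 0 < sN) (hST : sS < sT) (htT : st < sT)
    (hS0 : 0 < sS) (ht0 : 0 < st) :
    Tendsto (fun L => profileCorrection c (q ^ T L) (q ^ S L) (q ^ N L) (q ^ t L))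
      atTop (nhds 0) := by
  have a := hT.tendsto_zpow_zero hT0 hq hq1
  have n := hN.tendsto_zpow_zero hN0 hq hq1
  have s := hS.tendsto_zpow_zero hS0 hq hq1
  have τ := ht.tendsto_zpow_zero ht0 hq hq1
  have as := (hT.sub hS).tendsto_zpow_zero (sub_pos.mpr hST) hq hq1
  have aτ := (hT.sub ht).tendsto_zpow_zero (sub_pos.mpr htT) hq hq1
  have h := (((a.mul (n.pow 2)).sub ((n.pow 2).const_mul c)).add
    (n.mul ((as.add aτ).add (s.add τ)))).sub (a.div_const c)
  norm_num at h
  refine h.congr fun L => ?_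
  unfold profileCorrection
  rw [zpow_sub₀ hq.ne', zpow_sub₀ hq.ne']
  field_simp
  ring

theorem diagError_tendsto {q c : ℝ} (hq : 0 < q) (hq1 : q < 1) (hc : 0 < c)
    {T S N t X : ℕ → ℤ} {sT sS sN st sx : ℝ} (hT : HasRate T sT) (hS : HasRate S sS)
    (hN : HasRate N sN) (ht : HasRate t st) (hX : HasRate X sx) (hST : sS < sT) (htT : st < sT)
    (hS0 : 0 < sS) (hN0 : 0 < sN) (ht0 : 0 < st) (h₁ : sN < sS + st) (h₂ : sS < sN + st)
    (h₃ : st < sN + sS) (h₄ : sN + sS + st < 2 * sT) (δ : ℤ) :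
    Tendsto (fun L => diagError q c (T L) (S L) (N L) (t L)
      (max (N L - |2 * X L - S L - t L|) 0) (X L + δ)) atTop (nhds 0) := by
  have hT0 : 0 < sT := hS0.trans hST
  have hM := ((hN.sub (((hX.const_mul 2).sub hS).sub ht).abs).max (.const 0))
  have hx := hX.add (.const δ)
  have hE := (hM.sub hN).add ((hx.sub (hS.add ht)).max hx.neg)
  set μ : ℝ := max (sN - |((2 : ℤ) : ℝ) * sx - sS - st|) 0
  set ω : ℝ := max (sx + 0 - (sS + st)) (-(sx + 0))
  have hsum : (sN - sS - st) / 2 ≤ μ + ω := by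
    have e1 : sN - |((2 : ℤ) : ℝ) * sx - sS - st| ≤ μ := le_max_left _ _
    have e2 : 0 ≤ μ := le_max_right _ _
    have e3 : sx + 0 - (sS + st) ≤ ω := le_max_left _ _
    have e4 : -(sx + 0) ≤ ω := le_max_right _ _
    push_cast at e1
    rcases abs_choice (2 * sx - sS - st) with h | h <;> rw [h] at e1 <;> linarith
  have z := hT.tendsto_zpow_zero hT0 hq hq1
  have z1 := (hE.add hT).tendsto_zpow_zero (by linarith) hq hq1
  have z2 := (hE.add (hS.add ht)).tendsto_zpow_zero (by linarith) hq hq1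
  have z3 := (hE.add (hN.add hS)).tendsto_zpow_zero (by linarith) hq hq1
  have z4 := (hE.add (hN.add ht)).tendsto_zpow_zero (by linarith) hq hq1
  have z5 := (profileCorrection_tendsto (c := c) hq hq1 hT hS hN ht hT0 hN0 hST htT hS0 ht0).abs
  have hz := (z.add ((((z1.add z2).add z3).add z4).const_mul ((1 + c⁻¹) * (c + 1)))).add
    (z5.const_mul (q * (1 + q) * c * q ^ (2 * δ) + (1 + q) / (q * c) * q ^ (-(2 * δ))))
  norm_num at hz
  refine squeeze_zero_norm' ?_ hz
  filter_upwards [hT.eventually_pos hT0, hN.eventually_pos hN0] with L hTL hNL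
  rw [Real.norm_eq_abs]
  refine (diagError_abs_le hq hq1 hc (S L) (t L) (X L + δ) hTL.le hNL.le
    (le_max_right _ _)).trans ?_
  have hb := zpow_mul_profile_le hq hq1 hc (2 * δ)
    (k := max (N L - |2 * X L - S L - t L|) 0 - N L) (d := 2 * X L - S L - t L)
    (by have := le_max_left (N L - |2 * X L - S L - t L|) 0; linarith)
  rw [show 2 * (X L + δ) - S L - t L = 2 * δ + (2 * X L - S L - t L) by ring]
  have hb' := mul_le_mul_of_nonneg_right hb
    (abs_nonneg (profileCorrection c (q ^ T L) (q ^ S L) (q ^ N L) (q ^ t L)))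
  norm_num at hb' ⊢
  linarith

/-- Far from the axis `2x = S + t` on the left, at distance at most `N`, the leading term is
asymptotically constant. -/
theorem zpow_mul_profile_tendsto_left {q c : ℝ} (hq : 0 < q) (hc : 0 < c) {l : Filter ℕ}
    {k d : ℕ → ℤ} (δ : ℤ) (hk : ∀ᶠ L in l, k L = d L)
    (hd : Tendsto (fun L => q ^ (-d L)) l (nhds 0)) :
    Tendsto (fun L => q ^ k L * profile q c (q ^ (2 * δ + d L))) l
      (nhds (c⁻¹ * (1 + q) * q ^ (-1 - 2 * δ))) := by
  have hq' := hq.ne'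
  have hv := hd.const_mul (q ^ (-(2 * δ)))
  rw [mul_zero] at hv
  have h := Tendsto.div (tendsto_const_nhds (x := q * (1 + q) * c * q ^ (-(2 * δ))) (f := l))
    ((hv.add_const c).mul (hv.add_const (c * q ^ 2))) (by positivity)
  have hlim : q * (1 + q) * c * q ^ (-(2 * δ)) / ((0 + c) * (0 + c * q ^ 2)) =
      c⁻¹ * (1 + q) * q ^ (-1 - 2 * δ) := by
    rw [sub_eq_add_neg (-1 : ℤ), zpow_add₀ hq', zpow_neg_one]
    field_simp
    ring
  rw [hlim] at h
  refine h.congr' ?_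
  filter_upwards [hk] with L hL
  rw [Pi.div_apply]
  rw [hL, profile_eq_inv (zpow_pos hq _), ← zpow_neg, neg_add, zpow_add₀ hq', zpow_neg q (d L)]
  field_simp

/-- Mirror image of `zpow_mul_profile_tendsto_left`. -/
theorem zpow_mul_profile_tendsto_right {q c : ℝ} (hq : 0 < q) {l : Filter ℕ}
    {k d : ℕ → ℤ} (δ : ℤ) (hk : ∀ᶠ L in l, k L = -d L)
    (hd : Tendsto (fun L => q ^ d L) l (nhds 0)) :
    Tendsto (fun L => q ^ k L * profile q c (q ^ (2 * δ + d L))) l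
      (nhds (c * (1 + q) * q ^ (2 * δ + 1))) := by
  have hq' := hq.ne'
  have hv := hd.const_mul (q ^ (2 * δ))
  rw [mul_zero] at hv
  have h := Tendsto.div (tendsto_const_nhds (x := q * (1 + q) * c * q ^ (2 * δ)) (f := l))
    (((hv.const_mul c).const_add 1).mul ((hv.const_mul (c * q ^ 2)).const_add 1)) (by simp)
  have hlim : q * (1 + q) * c * q ^ (2 * δ) / ((1 + c * 0) * (1 + c * q ^ 2 * 0)) =
      c * (1 + q) * q ^ (2 * δ + 1) := by
    rw [zpow_add_one₀ hq']
    simp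
    ring
  rw [hlim] at h
  refine h.congr' ?_
  filter_upwards [hk] with L hL
  rw [Pi.div_apply]
  unfold profile
  rw [hL, zpow_add₀ hq', zpow_neg]
  field_simp

/-- the limit of the scaled diagonal coefficient of the q-Racah difference
operator, in all seven regimes of the macroscopic location `𝗑` on the slice `𝗍`. -/
theorem diag_coefficient_limit (sT sS sN st sx q c : ℝ)
    (hTS : sS < sT) (hS : 0 < sS) (hN : 0 < sN) (hNT : sN < sT)
    (hq : q ∈ Set.Ioo (0:ℝ) 1) (hc : 0 < c)
    (htl : |sN - sS| < st) (htr : st < min (sN + sS) (2 * sT - sN - sS))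
    (hH : inHex sT sS sN st sx) (Δx : ℤ) :
    (sx < (sS + st - sN) / 2 →
      Tendsto (diagScaled q c sT sS sN st sx Δx) atTop (nhds (-1))) ∧
    (sx = (sS + st - sN) / 2 →
      Tendsto (diagScaled q c sT sS sN st sx Δx)
        (atTop ⊓ Filter.principal {L : ℕ |
          2 * ⌊(L : ℝ) * sx⌋ = ⌊(L : ℝ) * sS⌋ + ⌊(L : ℝ) * st⌋ - ⌊(L : ℝ) * sN⌋})
        (nhds (-1 + c⁻¹ * (1 + q) * q ^ (-1 - 2 * Δx)))) ∧
    ((sS + st - sN) / 2 < sx → sx < (sS + st) / 2 →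
      Tendsto (diagScaled q c sT sS sN st sx Δx) atTop
        (nhds (c⁻¹ * (1 + q) * q ^ (-1 - 2 * Δx)))) ∧
    (sx = (sS + st) / 2 →
      Tendsto (diagScaled q c sT sS sN st sx Δx)
        (atTop ⊓ Filter.principal {L : ℕ |
          2 * ⌊(L : ℝ) * sx⌋ = ⌊(L : ℝ) * sS⌋ + ⌊(L : ℝ) * st⌋})
        (nhds (c * (1 + q) * q ^ (2 * Δx + 1) /
          ((1 + c * q ^ (2 * Δx)) * (1 + c * q ^ (2 * Δx + 2)))))) ∧
    ((sS + st) / 2 < sx → sx < (sS + st + sN) / 2 →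
      Tendsto (diagScaled q c sT sS sN st sx Δx) atTop
        (nhds (c * (1 + q) * q ^ (2 * Δx + 1)))) ∧
    (sx = (sS + st + sN) / 2 →
      Tendsto (diagScaled q c sT sS sN st sx Δx)
        (atTop ⊓ Filter.principal {L : ℕ |
          2 * ⌊(L : ℝ) * sx⌋ = ⌊(L : ℝ) * sS⌋ + ⌊(L : ℝ) * st⌋ + ⌊(L : ℝ) * sN⌋})
        (nhds (-1 + c * (1 + q) * q ^ (2 * Δx + 1)))) ∧
    ((sS + st + sN) / 2 < sx →
      Tendsto (diagScaled q c sT sS sN st sx Δx) atTop (nhds (-1))) := by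
  obtain ⟨hq0, hq1⟩ := hq
  obtain ⟨ht0, htT, -, -⟩ := hH
  obtain ⟨htr₁, htr₂⟩ := lt_min_iff.mp htr
  obtain ⟨htl₁, htl₂⟩ := abs_lt.mp htl
  set T : ℕ → ℤ := fun L => ⌊(L : ℝ) * sT⌋
  set S : ℕ → ℤ := fun L => ⌊(L : ℝ) * sS⌋
  set N : ℕ → ℤ := fun L => ⌊(L : ℝ) * sN⌋
  set t : ℕ → ℤ := fun L => ⌊(L : ℝ) * st⌋
  set X : ℕ → ℤ := fun L => ⌊(L : ℝ) * sx⌋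
  have rT : HasRate T sT := .floor sT
  have rS : HasRate S sS := .floor sS
  have rN : HasRate N sN := .floor sN
  have rt : HasRate t st := .floor st
  have rX : HasRate X sx := .floor sx
  set d : ℕ → ℤ := fun L => 2 * X L - S L - t L with hddef
  set M : ℕ → ℤ := fun L => max (N L - |d L|) 0 with hMdef
  have rd : HasRate d (2 * sx - sS - st) := by
    simpa using ((rX.const_mul 2).sub rS).sub rt
  have zN := rN.tendsto_zpow_zero hN hq0 hq1
  have hNpos := rN.eventually_pos hN
  have hE := diagError_tendsto hq0 hq1 hc rT rS rN rt rX hTS htT hS hN ht0 (by linarith)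
    (by linarith) htr₁ (by linarith) Δx
  have key : ∀ {l : Filter ℕ} {v w : ℝ}, l ≤ atTop →
      Tendsto (fun L => q ^ M L) l (nhds v) →
      Tendsto (fun L => q ^ (M L - N L) * profile q c (q ^ (2 * Δx + d L))) l (nhds w) →
      Tendsto (diagScaled q c sT sS sN st sx Δx) l (nhds (-v + w)) := by
    intro l v w hl hv hw
    have h := (hv.neg.add hw).add (hE.mono_left hl)
    rw [add_zero] at h
    refine h.congr fun L => ?_
    have hdx : 2 * Δx + d L = 2 * (X L + Δx) - S L - t L := by simp only [hddef]; ring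
    rw [hdx]
    exact (diag_eq_leading_add_error hq0 hc (T L) (S L) (N L) (t L) (M L) (X L + Δx)).symm
  have one_of_zero : ∀ {l : Filter ℕ}, (∀ᶠ L in l, M L = 0) →
      Tendsto (fun L => q ^ M L) l (nhds 1) := by
    intro l h
    refine tendsto_const_nhds.congr' ?_
    filter_upwards [h] with L hL
    rw [hL, zpow_zero]
  refine ⟨fun h => ?_, fun h => ?_, fun h h' => ?_, fun h => ?_, fun h h' => ?_, fun h => ?_,
    fun h => ?_⟩
  · have hM : ∀ᶠ L in atTop, M L = 0 := by
      filter_upwards [(rN.add rd).neg.eventually_pos (by linarith)] with L hL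
      exact max_eq_right (by have := neg_le_abs (d L); omega)
    have z := (rN.add rd).neg.tendsto_zpow_zero (by linarith) hq0 hq1
    have hw := z.const_mul ((1 + q) / (q * c) * q ^ (-(2 * Δx)))
    rw [mul_zero] at hw
    have := key le_rfl (one_of_zero hM) (squeeze_zero'
      (.of_forall fun L => mul_nonneg (zpow_pos hq0 _).le
        (profile_nonneg hq0 hc (zpow_pos hq0 _))) ?_ hw)
    · simpa using this
    · filter_upwards [hM] with L hL
      calc _ ≤ q ^ (M L - N L) * ((1 + q) / (q * c) * (q ^ (2 * Δx + d L))⁻¹) := by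
            have := zpow_pos hq0 (M L - N L)
            gcongr
            exact profile_le_mul_inv hq0 hc (zpow_pos hq0 _)
        _ = _ := by
            rw [hL, ← zpow_neg, zero_sub, neg_add, neg_add, zpow_add₀ hq0.ne', zpow_add₀ hq0.ne']
            ring
  · have hd : ∀ᶠ L in atTop ⊓ Filter.principal {L | 2 * X L = S L + t L - N L},
        d L = -N L ∧ M L = 0 := by
      filter_upwards [mem_inf_of_right (mem_principal_self _), mem_inf_of_left hNpos]
        with L hL hNL
      have hdL : d L = -N L := by
        have : 2 * X L = S L + t L - N L := hL
        simp only [hddef]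
        omega
      refine ⟨hdL, ?_⟩
      simp only [hMdef]
      rw [hdL, abs_neg, abs_of_pos hNL]
      simp
    refine key inf_le_left (one_of_zero (hd.mono fun L hL => hL.2))
      (zpow_mul_profile_tendsto_left hq0 hc Δx (hd.mono fun L hL => ?_)
        ((rd.neg.tendsto_zpow_zero (by linarith) hq0 hq1).mono_left inf_le_left))
    rw [hL.1, hL.2, zero_sub]
  · have hM : ∀ᶠ L in atTop, M L = N L + d L := by
      filter_upwards [(rN.add rd).eventually_pos (by linarith),
        rd.neg.eventually_pos (by linarith)] with L hL hL'
      simp only [hMdef]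
      rw [abs_of_neg (by omega), max_eq_left (by omega)]
      ring
    have hv : Tendsto (fun L => q ^ M L) _ (nhds 0) :=
      ((rN.add rd).tendsto_zpow_zero (by linarith) hq0 hq1).congr'
        (hM.mono fun L hL => by simp only [hL])
    simpa using key le_rfl hv (zpow_mul_profile_tendsto_left hq0 hc Δx
      (hM.mono fun L hL => by rw [hL]; ring)
      (rd.neg.tendsto_zpow_zero (by linarith) hq0 hq1))
  · have hd : ∀ᶠ L in atTop ⊓ Filter.principal {L | 2 * X L = S L + t L},
        d L = 0 ∧ M L = N L := by
      filter_upwards [mem_inf_of_right (mem_principal_self _), mem_inf_of_left hNpos]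
        with L hL hNL
      have hdL : d L = 0 := by
        have : 2 * X L = S L + t L := hL
        simp only [hddef]
        omega
      refine ⟨hdL, ?_⟩
      simp only [hMdef]
      rw [hdL, abs_zero, sub_zero, max_eq_left hNL.le]
    have hv : Tendsto (fun L => q ^ M L) _ (nhds 0) :=
      (zN.mono_left inf_le_left).congr' (hd.mono fun L hL => by simp only [hL.2])
    have hw : c * (1 + q) * q ^ (2 * Δx + 1) /
        ((1 + c * q ^ (2 * Δx)) * (1 + c * q ^ (2 * Δx + 2))) = profile q c (q ^ (2 * Δx)) := by
      unfold profile
      rw [zpow_add_one₀ hq0.ne', zpow_add₀ hq0.ne', zpow_ofNat]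
      ring
    have := key inf_le_left hv (tendsto_const_nhds (x := profile q c (q ^ (2 * Δx))).congr'
      (hd.mono fun L hL => by simp [hL.1, hL.2]))
    rw [hw]
    simpa using this
  · have hM : ∀ᶠ L in atTop, M L = N L - d L := by
      filter_upwards [(rN.sub rd).eventually_pos (by linarith),
        rd.eventually_pos (by linarith)] with L hL hL'
      simp only [hMdef]
      rw [abs_of_pos hL', max_eq_left hL.le]
    have hv : Tendsto (fun L => q ^ M L) _ (nhds 0) :=
      ((rN.sub rd).tendsto_zpow_zero (by linarith) hq0 hq1).congr'
        (hM.mono fun L hL => by simp only [hL])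
    simpa using key le_rfl hv (zpow_mul_profile_tendsto_right (c := c) hq0 Δx
      (hM.mono fun L hL => by rw [hL]; ring)
      (rd.tendsto_zpow_zero (by linarith) hq0 hq1))
  · have hd : ∀ᶠ L in atTop ⊓ Filter.principal {L | 2 * X L = S L + t L + N L},
        d L = N L ∧ M L = 0 := by
      filter_upwards [mem_inf_of_right (mem_principal_self _), mem_inf_of_left hNpos]
        with L hL hNL
      have hdL : d L = N L := by
        have : 2 * X L = S L + t L + N L := hL
        simp only [hddef]
        omega
      refine ⟨hdL, ?_⟩
      simp only [hMdef]
      rw [hdL, abs_of_pos hNL]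
      simp
    refine key inf_le_left (one_of_zero (hd.mono fun L hL => hL.2))
      (zpow_mul_profile_tendsto_right hq0 Δx (hd.mono fun L hL => ?_)
        ((rd.tendsto_zpow_zero (by linarith) hq0 hq1).mono_left inf_le_left))
    rw [hL.1, hL.2, zero_sub]
  · have hM : ∀ᶠ L in atTop, M L = 0 := by
      filter_upwards [(rd.sub rN).eventually_pos (by linarith)] with L hL
      exact max_eq_right (by have := le_abs_self (d L); omega)
    have z := (rd.sub rN).tendsto_zpow_zero (by linarith) hq0 hq1
    have hw := z.const_mul (q * (1 + q) * c * q ^ (2 * Δx))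
    rw [mul_zero] at hw
    have := key le_rfl (one_of_zero hM) (squeeze_zero'
      (.of_forall fun L => mul_nonneg (zpow_pos hq0 _).le
        (profile_nonneg hq0 hc (zpow_pos hq0 _))) ?_ hw)
    · simpa using this
    · filter_upwards [hM] with L hL
      calc _ ≤ q ^ (M L - N L) * (q * (1 + q) * c * q ^ (2 * Δx + d L)) := by
            have := zpow_pos hq0 (M L - N L)
            gcongr
            exact profile_le_mul hq0 hc (zpow_pos hq0 _)
        _ = _ := by
            rw [hL, zero_sub, sub_eq_add_neg, zpow_add₀ hq0.ne', zpow_add₀ hq0.ne']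
            ring
end

section
/- Fix reals 𝖳>𝖲>0, 𝖭>0 with 𝖭<𝖳 and parameters q∈(0,1), c>0; for a positive integer L set T=⌊L𝖳⌋, S=⌊L𝖲⌋, N=⌊L𝖭⌋, t=⌊L𝗍⌋, and x=⌊L𝗑⌋+Δx with fixed Δx∈ℤ, where 𝗍_l<𝗍<𝗍_r and (𝗍,𝗑)∈ℋ. Then for all sufficiently large L the quantity W₋(x) is nonnegative, and lim_{L→∞} C_L·√(W₋(x))·D̃(x) equals: 0 if 𝗑<(𝖲+𝗍−𝖭)/2; c^{−1}q^{−2Δx+1/2} if 𝗑=(𝖲+𝗍−𝖭)/2 and along the sequence 2⌊L𝗑⌋=S+t−N; c^{−1}q^{−2Δx+1/2} if (𝖲+𝗍−𝖭)/2<𝗑<(𝖲+𝗍)/2; c·q^{2Δx+1/2}/((1+cq^{2Δx})·√((1+cq^{2Δx−1})(1+cq^{2Δx+1}))) if 𝗑=(𝖲+𝗍)/2 and along the sequence 2⌊L𝗑⌋=S+t; c·q^{2Δx+1/2} if (𝖲+𝗍)/2<𝗑<(𝖲+𝗍+𝖭)/2; c·q^{2Δx+1/2} if 𝗑=(𝖲+𝗍+𝖭)/2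 and along the sequence 2⌊L𝗑⌋=S+t+N; and 0 if 𝗑>(𝖲+𝗍+𝖭)/2. -/
open Filter

/-- The backward weight ratio `W₋(x) = w^{qR}(x̃)/w^{qR}(x̃−1)` on the `t`-th slice. -/
noncomputable def Wminus (q c : ℝ) (T S N t x : ℤ) : ℝ :=
  (q ^ T + c * q ^ x) * (q ^ (N + S) - q ^ x) * (q ^ (N + t) - q ^ x) *
      (q ^ (S + t) + c * q ^ x) * (q ^ (S + t) + c * q ^ (2 * x + 1)) /
    ((1 - q ^ x) * (q ^ S + c * q ^ (N + x)) * (q ^ t + c * q ^ (N + x)) *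
      (q ^ (S + t + 1) + c * q ^ (2 * x)) * (q ^ (S + t) - q ^ (T + x)))

/-- The scaled off-diagonal coefficient `C_L·√(W₋(x))·D̃(x)` at `x = ⌊L𝗑⌋ + Δx` with
`T = ⌊L𝖳⌋, S = ⌊L𝖲⌋, N = ⌊L𝖭⌋, t = ⌊L𝗍⌋`. -/
noncomputable def offdiagScaled (q c sT sS sN st sx : ℝ) (Δx : ℤ) (L : ℕ) : ℝ :=
  Cpre q ⌊(L : ℝ) * sT⌋ ⌊(L : ℝ) * sS⌋ ⌊(L : ℝ) * sN⌋ ⌊(L : ℝ) * st⌋ ⌊(L : ℝ) * sx⌋ *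
    Real.sqrt (Wminus q c ⌊(L : ℝ) * sT⌋ ⌊(L : ℝ) * sS⌋ ⌊(L : ℝ) * sN⌋ ⌊(L : ℝ) * st⌋
        (⌊(L : ℝ) * sx⌋ + Δx)) *
    Dcoef q c ⌊(L : ℝ) * sT⌋ ⌊(L : ℝ) * sS⌋ ⌊(L : ℝ) * sN⌋ ⌊(L : ℝ) * st⌋
      (⌊(L : ℝ) * sx⌋ + Δx)

/-- The normalized denominator of the squared off-diagonal coefficient, with `u = 2x − S − t`. -/
noncomputable def denomFactor (q c : ℝ) (u : ℤ) : ℝ :=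
  (q + c * q ^ u) * (1 + c * q ^ u) ^ 2 * (1 + c * q ^ (u + 1))

/-- The factor of the squared coefficient that is sensitive to `x` being large. -/
noncomputable def upperFactor (q c : ℝ) (T S t x : ℤ) : ℝ :=
  (c + q ^ (T - x)) * (c + q ^ (S + t - x))

/-- The factor of the squared coefficient that is sensitive to `x` being small. -/
noncomputable def lowerFactor (q c : ℝ) (S N t x : ℤ) : ℝ :=
  (1 + c * q ^ (N + x - S)) * (1 + c * q ^ (N + x - t))

/-- The factor of the squared coefficient that tends to one throughout the hexagon. -/
noncomputable def hexFactor (q : ℝ) (T S N t x : ℤ) : ℝ :=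
  (1 - q ^ (N + S - x)) * (1 - q ^ (N + t - x)) * (1 - q ^ x) * (1 - q ^ (T + x - S - t))

theorem Wminus_nonneg {q c : ℝ} (hq0 : 0 < q) (hq1 : q < 1) (hc : 0 < c) {T S N t x : ℤ}
    (hx : 0 < x) (hxS : x < N + S) (hxt : x < N + t) (hxT : S + t < T + x) :
    0 ≤ Wminus q c T S N t x := by
  have h1 : 0 ≤ 1 - q ^ x := sub_nonneg.2 (zpow_lt_one₀ hq0 hq1 hx).le
  have h2 : 0 ≤ q ^ x - q ^ (N + S) :=
    sub_nonneg.2 (zpow_right_strictAnti₀ hq0 hq1 hxS).le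
  have h3 : 0 ≤ q ^ x - q ^ (N + t) :=
    sub_nonneg.2 (zpow_right_strictAnti₀ hq0 hq1 hxt).le
  have h4 : 0 ≤ q ^ (S + t) - q ^ (T + x) :=
    sub_nonneg.2 (zpow_right_strictAnti₀ hq0 hq1 hxT).le
  have h5 : Wminus q c T S N t x =
      (q ^ T + c * q ^ x) * (q ^ x - q ^ (N + S)) * (q ^ x - q ^ (N + t)) *
      (q ^ (S + t) + c * q ^ x) * (q ^ (S + t) + c * q ^ (2 * x + 1)) /
    ((1 - q ^ x) * (q ^ S + c * q ^ (N + x)) * (q ^ t + c * q ^ (N + x)) *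
      (q ^ (S + t + 1) + c * q ^ (2 * x)) * (q ^ (S + t) - q ^ (T + x))) := by
    unfold Wminus
    congr 1
    ring
  rw [h5]
  positivity

theorem Dcoef_nonneg {q c : ℝ} (hq0 : 0 < q) (hq1 : q < 1) (hc : 0 < c) {T S N t x : ℤ}
    (hx : 0 < x) (hxT : S + t < T + x) :
    0 ≤ Dcoef q c T S N t x := by
  have h1 : 0 ≤ 1 - q ^ x := sub_nonneg.2 (zpow_lt_one₀ hq0 hq1 hx).le
  have h4 : 0 ≤ q ^ (S + t) - q ^ (T + x) :=
    sub_nonneg.2 (zpow_right_strictAnti₀ hq0 hq1 hxT).le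
  unfold Dcoef
  positivity

theorem sq_mul_Wminus_mul_Dcoef_sq {q c : ℝ} (hq0 : 0 < q) (hq1 : q < 1) (hc : 0 < c)
    {T S N t x : ℤ} (M : ℤ) (hx : 0 < x) (hxT : S + t < T + x) :
    (q ^ (N + T + M)) ^ 2 * Wminus q c T S N t x * Dcoef q c T S N t x ^ 2 =
      q ^ (2 * M - 2 * N + 2 + 2 * (2 * x - S - t)) * upperFactor q c T S t x *
        lowerFactor q c S N t x * hexFactor q T S N t x / denomFactor q c (2 * x - S - t) := by
  have h1 : 1 - q ^ x ≠ 0 := (sub_pos.2 (zpow_lt_one₀ hq0 hq1 hx)).ne'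
  have h2 : q ^ (S + t) - q ^ (T + x) ≠ 0 :=
    (sub_pos.2 (zpow_right_strictAnti₀ hq0 hq1 hxT)).ne'
  have e1 : -2 * N - T + 1 = 1 - (N + N + T) := by ring
  unfold Wminus Dcoef upperFactor lowerFactor hexFactor denomFactor
  simp only [e1, two_mul, zpow_add₀ hq0.ne', zpow_sub₀ hq0.ne', zpow_one] at h1 h2 ⊢
  have ha : 0 < q ^ T := by positivity
  have hb : 0 < q ^ S := by positivity
  have hn : 0 < q ^ N := by positivity
  have hd : 0 < q ^ t := by positivity
  have hy : 0 < q ^ x := by positivity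
  have hm : 0 < q ^ M := by positivity
  have hq2 : q ^ (2 : ℤ) = q * q := by rw [zpow_ofNat, pow_two]
  rw [hq2]
  generalize q ^ T = a at *
  generalize q ^ S = b at *
  generalize q ^ N = n at *
  generalize q ^ t = d at *
  generalize q ^ x = y at *
  generalize q ^ M = m at *
  have p1 : b + c * (n * y) ≠ 0 := by positivity
  have p2 : d + c * (n * y) ≠ 0 := by positivity
  have p3 : b * d * q + c * (y * y) ≠ 0 := by positivity
  have p4 : b * d + c * (y * y) ≠ 0 := by positivity
  have p5 : b * d + c * (y * y * q) ≠ 0 := by positivity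
  have g : (q + c * (y * y / b / d)) * (1 + c * (y * y / b / d)) ^ 2 *
      (1 + c * (y * y / b / d * q)) =
      (b * d * q + c * (y * y)) * (b * d + c * (y * y)) ^ 2 * (b * d + c * (y * y * q)) /
        (b * d) ^ 4 := by
    field_simp
  rw [g]
  field_simp
  ring

theorem offdiag_eq_sqrt {q c : ℝ} (hq0 : 0 < q) (hq1 : q < 1) (hc : 0 < c)
    {T S N t x : ℤ} (X : ℤ) (hx : 0 < x) (hxT : S + t < T + x) :
    Cpre q T S N t X * Real.sqrt (Wminus q c T S N t x) * Dcoef q c T S N t x =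
      Real.sqrt (q ^ (2 * max (N - |2 * X - S - t|) 0 - 2 * N + 2 + 2 * (2 * x - S - t)) *
        upperFactor q c T S t x * lowerFactor q c S N t x * hexFactor q T S N t x /
          denomFactor q c (2 * x - S - t)) := by
  have hD := Dcoef_nonneg (N := N) hq0 hq1 hc hx hxT
  have hC : 0 ≤ Cpre q T S N t X := by unfold Cpre; positivity
  rw [← sq_mul_Wminus_mul_Dcoef_sq hq0 hq1 hc _ hx hxT, Real.sqrt_mul' _ (sq_nonneg _),
    Real.sqrt_mul (sq_nonneg _), Real.sqrt_sq hD, ← Cpre, Real.sqrt_sq hC]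

theorem denomFactor_eq {q c : ℝ} (hq0 : 0 < q) (u : ℤ) :
    denomFactor q c u = q ^ (4 * u) *
      ((q * q ^ (-u) + c) * (q ^ (-u) + c) ^ 2 * (q ^ (-u) + c * q)) := by
  have h : q ^ (4 * u) = (q ^ u) ^ 4 := by rw [mul_comm, zpow_mul]; norm_cast
  rw [h, denomFactor, zpow_neg, zpow_add_one₀ hq0.ne']
  have : q ^ u ≠ 0 := by positivity
  field_simp

theorem tendsto_floor_combination (sT sS sN st sx : ℝ) (a b d e f m : ℤ)
    (h : 0 < a * sT + b * sS + d * sN + e * st + f * sx) :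
    Tendsto (fun L : ℕ => a * ⌊(L : ℝ) * sT⌋ + b * ⌊(L : ℝ) * sS⌋ + d * ⌊(L : ℝ) * sN⌋ +
      e * ⌊(L : ℝ) * st⌋ + f * ⌊(L : ℝ) * sx⌋ + m) atTop atTop := by
  have bound : ∀ (k : ℤ) (y : ℝ), k * y - |(k : ℝ)| ≤ k * (⌊y⌋ : ℝ) := by
    intro k y
    have h1 : |(k : ℝ) * (y - ⌊y⌋)| ≤ |(k : ℝ)| * 1 := by
      rw [abs_mul]
      gcongr
      rw [abs_le]
      constructor <;> linarith [Int.floor_le y, Int.lt_floor_add_one y]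
    linarith [le_abs_self ((k : ℝ) * (y - ⌊y⌋))]
  rw [← tendsto_intCast_atTop_iff (R := ℝ)]
  have lin : Tendsto (fun L : ℕ => (L : ℝ) * (a * sT + b * sS + d * sN + e * st + f * sx) +
      (m - |(a : ℝ)| - |(b : ℝ)| - |(d : ℝ)| - |(e : ℝ)| - |(f : ℝ)|)) atTop atTop :=
    tendsto_atTop_add_const_right _ _ (tendsto_natCast_atTop_atTop.atTop_mul_const h)
  refine tendsto_atTop_mono (fun L => ?_) lin
  push_cast
  linarith [bound a (L * sT), bound b (L * sS), bound d (L * sN), bound e (L * st),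
    bound f (L * sx)]

theorem tendsto_zpow_zero {ι : Type*} {l : Filter ι} {q : ℝ} (hq0 : 0 < q) (hq1 : q < 1)
    {k : ι → ℤ} (hk : Tendsto k l atTop) : Tendsto (fun i => q ^ k i) l (nhds 0) := by
  have h1 : Tendsto (fun i => (k i).toNat) l atTop := by
    rw [tendsto_atTop] at hk ⊢
    intro n
    filter_upwards [hk n] with i hi
    omega
  refine ((tendsto_pow_atTop_nhds_zero_of_lt_one hq0.le hq1).comp h1).congr' ?_
  filter_upwards [hk.eventually_ge_atTop 0] with i hi
  rw [Function.comp_apply, ← zpow_natCast, Int.toNat_of_nonneg hi]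

theorem tendsto_denomFactor {ι : Type*} {l : Filter ι} {q c : ℝ} (hq0 : 0 < q) (hq1 : q < 1)
    {u : ι → ℤ} (hu : Tendsto u l atTop) :
    Tendsto (fun i => denomFactor q c (u i)) l (nhds q) := by
  have h := tendsto_zpow_zero hq0 hq1 hu
  have h' := tendsto_zpow_zero hq0 hq1 (tendsto_atTop_add_const_right l 1 hu)
  have := (((h.const_mul c).const_add q).mul (((h.const_mul c).const_add 1).pow 2)).mul
    ((h'.const_mul c).const_add 1)
  simpa [denomFactor] using this

theorem tendsto_zpow_div_denomFactor {ι : Type*} {l : Filter ι} {q c : ℝ} (hq0 : 0 < q)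
    (hq1 : q < 1) (hc : 0 < c) {u : ι → ℤ} (hu : Tendsto (fun i => -u i) l atTop) :
    Tendsto (fun i => q ^ (4 * u i) / denomFactor q c (u i)) l (nhds (c ^ 4 * q)⁻¹) := by
  have h := tendsto_zpow_zero hq0 hq1 hu
  have h2 := ((((h.const_mul q).add_const c).mul ((h.add_const c).pow 2)).mul
    (h.add_const (c * q))).inv₀ (by positivity)
  have e : (c ^ 4 * q)⁻¹ = ((q * 0 + c) * (0 + c) ^ 2 * (0 + c * q))⁻¹ := by
    congr 1
    ring
  rw [e]
  refine h2.congr fun i => ?_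
  have : q ^ (4 * u i) ≠ 0 := by positivity
  rw [denomFactor_eq hq0, ← div_div, div_self this, one_div]

theorem tendsto_upperFactor {ι : Type*} {l : Filter ι} {q c : ℝ} (hq0 : 0 < q) (hq1 : q < 1)
    {T S t x : ι → ℤ} (h₁ : Tendsto (fun i => T i - x i) l atTop)
    (h₂ : Tendsto (fun i => S i + t i - x i) l atTop) :
    Tendsto (fun i => upperFactor q c (T i) (S i) (t i) (x i)) l (nhds (c ^ 2)) := by
  simpa [upperFactor, pow_two] using
    ((tendsto_zpow_zero hq0 hq1 h₁).const_add c).mul ((tendsto_zpow_zero hq0 hq1 h₂).const_add c)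

theorem tendsto_lowerFactor {ι : Type*} {l : Filter ι} {q c : ℝ} (hq0 : 0 < q) (hq1 : q < 1)
    {S N t x : ι → ℤ} (h₁ : Tendsto (fun i => N i + x i - S i) l atTop)
    (h₂ : Tendsto (fun i => N i + x i - t i) l atTop) :
    Tendsto (fun i => lowerFactor q c (S i) (N i) (t i) (x i)) l (nhds 1) := by
  simpa [lowerFactor] using
    (((tendsto_zpow_zero hq0 hq1 h₁).const_mul c).const_add 1).mul
      (((tendsto_zpow_zero hq0 hq1 h₂).const_mul c).const_add 1)

theorem tendsto_hexFactor {ι : Type*} {l : Filter ι} {q : ℝ} (hq0 : 0 < q) (hq1 : q < 1)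
    {T S N t x : ι → ℤ} (h₁ : Tendsto (fun i => N i + S i - x i) l atTop)
    (h₂ : Tendsto (fun i => N i + t i - x i) l atTop) (h₃ : Tendsto x l atTop)
    (h₄ : Tendsto (fun i => T i + x i - S i - t i) l atTop) :
    Tendsto (fun i => hexFactor q (T i) (S i) (N i) (t i) (x i)) l (nhds 1) := by
  simpa [hexFactor] using
    ((((tendsto_zpow_zero hq0 hq1 h₁).const_sub 1).mul
      ((tendsto_zpow_zero hq0 hq1 h₂).const_sub 1)).mul
      ((tendsto_zpow_zero hq0 hq1 h₃).const_sub 1)).mul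
      ((tendsto_zpow_zero hq0 hq1 h₄).const_sub 1)

theorem tendsto_zpow_mul_upperFactor {ι : Type*} {l : Filter ι} {q c : ℝ} (hq0 : 0 < q)
    (hq1 : q < 1) {k T S t x : ι → ℤ} (h₀ : Tendsto k l atTop)
    (h₁ : Tendsto (fun i => k i + (T i - x i)) l atTop)
    (h₂ : Tendsto (fun i => k i + (S i + t i - x i)) l atTop)
    (h₃ : Tendsto (fun i => k i + (T i - x i) + (S i + t i - x i)) l atTop) :
    Tendsto (fun i => q ^ k i * upperFactor q c (T i) (S i) (t i) (x i)) l (nhds 0) := by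
  have h := ((((tendsto_zpow_zero hq0 hq1 h₀).const_mul (c ^ 2)).add
    ((tendsto_zpow_zero hq0 hq1 h₁).const_mul c)).add
    ((tendsto_zpow_zero hq0 hq1 h₂).const_mul c)).add (tendsto_zpow_zero hq0 hq1 h₃)
  simp only [mul_zero, add_zero] at h
  refine h.congr fun i => ?_
  simp only [upperFactor, zpow_add₀ hq0.ne' (k i), zpow_add₀ hq0.ne' (k i + (T i - x i))]
  ring

theorem tendsto_zpow_mul_lowerFactor {ι : Type*} {l : Filter ι} {q c : ℝ} (hq0 : 0 < q)
    (hq1 : q < 1) {k S N t x : ι → ℤ} (h₀ : Tendsto k l atTop)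
    (h₁ : Tendsto (fun i => k i + (N i + x i - S i)) l atTop)
    (h₂ : Tendsto (fun i => k i + (N i + x i - t i)) l atTop)
    (h₃ : Tendsto (fun i => k i + (N i + x i - S i) + (N i + x i - t i)) l atTop) :
    Tendsto (fun i => q ^ k i * lowerFactor q c (S i) (N i) (t i) (x i)) l (nhds 0) := by
  have h := (((tendsto_zpow_zero hq0 hq1 h₀).add
    ((tendsto_zpow_zero hq0 hq1 h₁).const_mul c)).add
    ((tendsto_zpow_zero hq0 hq1 h₂).const_mul c)).add
    ((tendsto_zpow_zero hq0 hq1 h₃).const_mul (c ^ 2))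
  simp only [mul_zero, add_zero] at h
  refine h.congr fun i => ?_
  simp only [lowerFactor, zpow_add₀ hq0.ne' (k i), zpow_add₀ hq0.ne' (k i + (N i + x i - S i))]
  ring

theorem rpow_two_mul_add_half_sq {q : ℝ} (hq0 : 0 < q) (m : ℤ) :
    (q ^ (2 * (m : ℝ) + 1 / 2)) ^ 2 = q ^ (4 * m + 1) := by
  rw [← Real.rpow_natCast, ← Real.rpow_mul hq0.le, ← Real.rpow_intCast]
  congr 1
  push_cast
  ring

/-- eventual nonnegativity of the backward weight ratio, and the limit of the
scaled off-diagonal coefficient of the q-Racah difference operator, in all seven regimes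
of the macroscopic location `𝗑` on the slice `𝗍`. -/
theorem offdiag_coefficient_limit (sT sS sN st sx q c : ℝ)
    (hTS : sS < sT) (hS : 0 < sS) (hN : 0 < sN) (hNT : sN < sT)
    (hq : q ∈ Set.Ioo (0:ℝ) 1) (hc : 0 < c)
    (htl : |sN - sS| < st) (htr : st < min (sN + sS) (2 * sT - sN - sS))
    (hH : inHex sT sS sN st sx) (Δx : ℤ) :
    (∀ᶠ L : ℕ in atTop,
      0 ≤ Wminus q c ⌊(L : ℝ) * sT⌋ ⌊(L : ℝ) * sS⌋ ⌊(L : ℝ) * sN⌋ ⌊(L : ℝ) * st⌋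
          (⌊(L : ℝ) * sx⌋ + Δx)) ∧
    (sx < (sS + st - sN) / 2 →
      Tendsto (offdiagScaled q c sT sS sN st sx Δx) atTop (nhds 0)) ∧
    (sx = (sS + st - sN) / 2 →
      Tendsto (offdiagScaled q c sT sS sN st sx Δx)
        (atTop ⊓ Filter.principal {L : ℕ |
          2 * ⌊(L : ℝ) * sx⌋ = ⌊(L : ℝ) * sS⌋ + ⌊(L : ℝ) * st⌋ - ⌊(L : ℝ) * sN⌋})
        (nhds (c⁻¹ * q ^ ((-2 * (Δx : ℝ)) + 1 / 2)))) ∧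
    ((sS + st - sN) / 2 < sx → sx < (sS + st) / 2 →
      Tendsto (offdiagScaled q c sT sS sN st sx Δx) atTop
        (nhds (c⁻¹ * q ^ ((-2 * (Δx : ℝ)) + 1 / 2)))) ∧
    (sx = (sS + st) / 2 →
      Tendsto (offdiagScaled q c sT sS sN st sx Δx)
        (atTop ⊓ Filter.principal {L : ℕ |
          2 * ⌊(L : ℝ) * sx⌋ = ⌊(L : ℝ) * sS⌋ + ⌊(L : ℝ) * st⌋})
        (nhds (c * q ^ ((2 * (Δx : ℝ)) + 1 / 2) /
          ((1 + c * q ^ (2 * Δx)) *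
            Real.sqrt ((1 + c * q ^ (2 * Δx - 1)) * (1 + c * q ^ (2 * Δx + 1))))))) ∧
    ((sS + st) / 2 < sx → sx < (sS + st + sN) / 2 →
      Tendsto (offdiagScaled q c sT sS sN st sx Δx) atTop
        (nhds (c * q ^ ((2 * (Δx : ℝ)) + 1 / 2)))) ∧
    (sx = (sS + st + sN) / 2 →
      Tendsto (offdiagScaled q c sT sS sN st sx Δx)
        (atTop ⊓ Filter.principal {L : ℕ |
          2 * ⌊(L : ℝ) * sx⌋ = ⌊(L : ℝ) * sS⌋ + ⌊(L : ℝ) * st⌋ + ⌊(L : ℝ) * sN⌋})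
        (nhds (c * q ^ ((2 * (Δx : ℝ)) + 1 / 2)))) ∧
    ((sS + st + sN) / 2 < sx →
      Tendsto (offdiagScaled q c sT sS sN st sx Δx) atTop (nhds 0)) := by
  obtain ⟨hq0, hq1⟩ := hq
  obtain ⟨-, -, hx₁, hx₂⟩ := hH
  obtain ⟨hx0, hxT⟩ := max_lt_iff.1 hx₁
  obtain ⟨hxS, hxt⟩ := lt_min_iff.1 hx₂
  obtain ⟨ht₁, ht₂⟩ := lt_min_iff.1 htr
  obtain ⟨ht₃, ht₄⟩ := abs_lt.1 htl
  set T : ℕ → ℤ := fun L => ⌊(L : ℝ) * sT⌋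
  set S : ℕ → ℤ := fun L => ⌊(L : ℝ) * sS⌋
  set N : ℕ → ℤ := fun L => ⌊(L : ℝ) * sN⌋
  set t : ℕ → ℤ := fun L => ⌊(L : ℝ) * st⌋
  set X : ℕ → ℤ := fun L => ⌊(L : ℝ) * sx⌋
  have key : ∀ {k : ℕ → ℤ} (a b d e f m : ℤ),
      0 < a * sT + b * sS + d * sN + e * st + f * sx →
      (∀ L, k L = a * T L + b * S L + d * N L + e * t L + f * X L + m) →
      Tendsto k atTop atTop := by
    intro k a b d e f m h hk
    rw [funext hk]
    exact tendsto_floor_combination sT sS sN st sx a b d e f m h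
  have kx : Tendsto (fun L => X L + Δx) atTop atTop :=
    key 0 0 0 0 1 Δx (by push_cast; linarith) (fun L => by ring)
  have kxS : Tendsto (fun L => N L + S L - (X L + Δx)) atTop atTop :=
    key 0 1 1 0 (-1) (-Δx) (by push_cast; linarith) (fun L => by ring)
  have kxt : Tendsto (fun L => N L + t L - (X L + Δx)) atTop atTop :=
    key 0 0 1 1 (-1) (-Δx) (by push_cast; linarith) (fun L => by ring)
  have kxT : Tendsto (fun L => T L + (X L + Δx) - S L - t L) atTop atTop :=
    key 1 (-1) 0 (-1) 1 Δx (by push_cast; linarith) (fun L => by ring)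
  have hexLim := tendsto_hexFactor hq0 hq1 kxS kxt kx kxT
  have toSqrt : offdiagScaled q c sT sS sN st sx Δx =ᶠ[atTop] fun L => Real.sqrt
      (q ^ (2 * max (N L - |2 * X L - S L - t L|) 0 - 2 * N L + 2 +
          2 * (2 * (X L + Δx) - S L - t L)) *
        upperFactor q c (T L) (S L) (t L) (X L + Δx) *
        lowerFactor q c (S L) (N L) (t L) (X L + Δx) *
        hexFactor q (T L) (S L) (N L) (t L) (X L + Δx) /
          denomFactor q c (2 * (X L + Δx) - S L - t L)) := by
    filter_upwards [kx.eventually_gt_atTop 0, kxT.eventually_gt_atTop 0] with L h₁ h₂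
    exact offdiag_eq_sqrt hq0 hq1 hc _ h₁ (by linarith)
  have squared : ∀ {l : Filter ℕ} {f : ℕ → ℝ} {w : ℝ}, l ≤ atTop → 0 ≤ w →
      Tendsto f l (nhds (w ^ 2)) →
      (∀ᶠ L in l, f L = q ^ (2 * max (N L - |2 * X L - S L - t L|) 0 - 2 * N L + 2 +
          2 * (2 * (X L + Δx) - S L - t L)) *
        upperFactor q c (T L) (S L) (t L) (X L + Δx) *
        lowerFactor q c (S L) (N L) (t L) (X L + Δx) *
        hexFactor q (T L) (S L) (N L) (t L) (X L + Δx) /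
          denomFactor q c (2 * (X L + Δx) - S L - t L)) →
      Tendsto (offdiagScaled q c sT sS sN st sx Δx) l (nhds w) := by
    intro l f w hl hw hf hfe
    have h := hf.sqrt
    rw [Real.sqrt_sq hw] at h
    refine h.congr' ?_
    filter_upwards [hfe, toSqrt.filter_mono hl] with L h₁ h₂
    rw [h₂, h₁]
  have upperLim : sx ≤ (sS + st + sN) / 2 →
      Tendsto (fun L => upperFactor q c (T L) (S L) (t L) (X L + Δx)) atTop (nhds (c ^ 2)) :=
    fun h => tendsto_upperFactor hq0 hq1
      (key 1 0 0 0 (-1) (-Δx) (by push_cast; linarith) (fun L => by ring))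
      (key 0 1 0 1 (-1) (-Δx) (by push_cast; linarith) (fun L => by ring))
  have lowerLim : (sS + st - sN) / 2 ≤ sx →
      Tendsto (fun L => lowerFactor q c (S L) (N L) (t L) (X L + Δx)) atTop (nhds 1) :=
    fun h => tendsto_lowerFactor hq0 hq1
      (key 0 (-1) 1 0 1 Δx (by push_cast; linarith) (fun L => by ring))
      (key 0 0 1 (-1) 1 Δx (by push_cast; linarith) (fun L => by ring))
  have leftHalf : ∀ {l : Filter ℕ}, l ≤ atTop → (sS + st - sN) / 2 ≤ sx → sx < (sS + st) / 2 →
      (∀ᶠ L in l, 0 ≤ N L - |2 * X L - S L - t L|) →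
      Tendsto (offdiagScaled q c sT sS sN st sx Δx) l
        (nhds (c⁻¹ * q ^ ((-2 * (Δx : ℝ)) + 1 / 2))) := by
    intro l hl h₁ h₂ hM
    have hu : Tendsto (fun L => -(2 * (X L + Δx) - S L - t L)) atTop atTop :=
      key 0 1 0 1 (-2) (-2 * Δx) (by push_cast; linarith) (fun L => by ring)
    have hU : Tendsto (fun L => -(2 * X L - S L - t L)) atTop atTop :=
      key 0 1 0 1 (-2) 0 (by push_cast; linarith) (fun L => by ring)
    have lim := ((((tendsto_zpow_div_denomFactor hq0 hq1 hc hu).const_mul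
      (q ^ (2 - 4 * Δx))).mul (upperLim (by linarith))).mul (lowerLim h₁)).mul hexLim
    refine squared hl (by positivity) (f := fun L => q ^ (2 - 4 * Δx) *
      (q ^ (4 * (2 * (X L + Δx) - S L - t L)) / denomFactor q c (2 * (X L + Δx) - S L - t L)) *
      upperFactor q c (T L) (S L) (t L) (X L + Δx) *
      lowerFactor q c (S L) (N L) (t L) (X L + Δx) *
      hexFactor q (T L) (S L) (N L) (t L) (X L + Δx)) ?_ ?_
    · convert lim.mono_left hl using 2
      have h := rpow_two_mul_add_half_sq hq0 (-Δx)
      have e : (-2 * (Δx : ℝ)) = 2 * ((-Δx : ℤ) : ℝ) := by push_cast; ring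
      have e' : (2 - 4 * Δx) = (4 * -Δx + 1) + 1 := by ring
      rw [mul_pow, e, h, e', zpow_add_one₀ hq0.ne' (4 * -Δx + 1)]
      field_simp
    · filter_upwards [hM, hl (hU.eventually_ge_atTop 0)] with L hL₁ hL₂
      rw [max_eq_left hL₁, abs_of_nonpos (by linarith)]
      have e : 2 * (N L - -(2 * X L - S L - t L)) - 2 * N L + 2 +
          2 * (2 * (X L + Δx) - S L - t L) =
          (2 - 4 * Δx) + 4 * (2 * (X L + Δx) - S L - t L) := by ring
      rw [e, zpow_add₀ hq0.ne']
      ring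
  have rightHalf : ∀ {l : Filter ℕ}, l ≤ atTop → (sS + st) / 2 < sx → sx ≤ (sS + st + sN) / 2 →
      (∀ᶠ L in l, 0 ≤ N L - |2 * X L - S L - t L|) →
      Tendsto (offdiagScaled q c sT sS sN st sx Δx) l
        (nhds (c * q ^ ((2 * (Δx : ℝ)) + 1 / 2))) := by
    intro l hl h₁ h₂ hM
    have hu : Tendsto (fun L => 2 * (X L + Δx) - S L - t L) atTop atTop :=
      key 0 (-1) 0 (-1) 2 (2 * Δx) (by push_cast; linarith) (fun L => by ring)
    have hU : Tendsto (fun L => 2 * X L - S L - t L) atTop atTop :=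
      key 0 (-1) 0 (-1) 2 0 (by push_cast; linarith) (fun L => by ring)
    have lim := (((((upperLim h₂).const_mul (q ^ (2 + 4 * Δx))).mul
      (lowerLim (by linarith))).mul hexLim).div (tendsto_denomFactor (c := c) hq0 hq1 hu) hq0.ne')
    refine squared hl (by positivity) (f := fun L => q ^ (2 + 4 * Δx) *
      upperFactor q c (T L) (S L) (t L) (X L + Δx) *
      lowerFactor q c (S L) (N L) (t L) (X L + Δx) *
      hexFactor q (T L) (S L) (N L) (t L) (X L + Δx) /
        denomFactor q c (2 * (X L + Δx) - S L - t L)) ?_ ?_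
    · have e : (c * q ^ (2 * (Δx : ℝ) + 1 / 2)) ^ 2 = q ^ (2 + 4 * Δx) * c ^ 2 * 1 * 1 / q := by
        have e' : (2 + 4 * Δx) = (4 * Δx + 1) + 1 := by ring
        rw [mul_pow, rpow_two_mul_add_half_sq hq0, e', zpow_add_one₀ hq0.ne' (4 * Δx + 1)]
        field_simp
      rw [e]
      exact lim.mono_left hl
    · filter_upwards [hM, hl (hU.eventually_ge_atTop 0)] with L hL₁ hL₂
      rw [max_eq_left hL₁, abs_of_nonneg hL₂]
      have e : 2 * (N L - (2 * X L - S L - t L)) - 2 * N L + 2 +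
          2 * (2 * (X L + Δx) - S L - t L) = 2 + 4 * Δx := by ring
      rw [e]
  have kN : Tendsto N atTop atTop :=
    key 0 0 1 0 0 0 (by push_cast; linarith) (fun L => by ring)
  refine ⟨?_, ?_, ?_, ?_, ?_, ?_, ?_, ?_⟩
  · filter_upwards [kx.eventually_gt_atTop 0, kxS.eventually_gt_atTop 0,
      kxt.eventually_gt_atTop 0, kxT.eventually_gt_atTop 0] with L h₁ h₂ h₃ h₄
    exact Wminus_nonneg hq0 hq1 hc h₁ (by linarith) (by linarith) (by linarith)
  · intro h
    have hu : Tendsto (fun L => -(2 * (X L + Δx) - S L - t L)) atTop atTop :=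
      key 0 1 0 1 (-2) (-2 * Δx) (by push_cast; linarith) (fun L => by ring)
    have hU : Tendsto (fun L => -(2 * X L - S L - t L) - N L) atTop atTop :=
      key 0 1 (-1) 1 (-2) 0 (by push_cast; linarith) (fun L => by ring)
    have small := tendsto_zpow_mul_lowerFactor (c := c) hq0 hq1
      (k := fun L => 2 - 2 * N L - 2 * (2 * (X L + Δx) - S L - t L))
      (S := S) (N := N) (t := t) (x := fun L => X L + Δx)
      (key 0 2 (-2) 2 (-4) (2 - 4 * Δx) (by push_cast; linarith) (fun L => by ring))
      (key 0 1 (-1) 2 (-3) (2 - 3 * Δx) (by push_cast; linarith) (fun L => by ring))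
      (key 0 2 (-1) 1 (-3) (2 - 3 * Δx) (by push_cast; linarith) (fun L => by ring))
      (key 0 1 0 1 (-2) (2 - 2 * Δx) (by push_cast; linarith) (fun L => by ring))
    have lim := ((small.mul (tendsto_zpow_div_denomFactor hq0 hq1 hc hu)).mul
      (upperLim (by linarith))).mul hexLim
    refine squared le_rfl le_rfl (by simpa only [zero_mul, zero_pow two_ne_zero] using lim) ?_
    filter_upwards [hU.eventually_ge_atTop 0, kN.eventually_ge_atTop 0] with L hL₁ hL₂
    rw [abs_of_nonpos (by linarith), max_eq_right (by linarith)]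
    have e : 2 * 0 - 2 * N L + 2 + 2 * (2 * (X L + Δx) - S L - t L) =
        (2 - 2 * N L - 2 * (2 * (X L + Δx) - S L - t L)) +
          4 * (2 * (X L + Δx) - S L - t L) := by ring
    rw [e, zpow_add₀ hq0.ne']
    ring
  · intro h
    refine leftHalf inf_le_left h.ge (by linarith) ?_
    filter_upwards [mem_inf_of_right (mem_principal_self _),
      mem_inf_of_left (kN.eventually_ge_atTop 0)] with L hL hL₀
    have hL' : 2 * X L = S L + t L - N L := hL
    rw [abs_of_nonpos (by linarith)]
    linarith
  · intro h₁ h₂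
    refine leftHalf le_rfl h₁.le h₂ ?_
    have hU : Tendsto (fun L => -(2 * X L - S L - t L)) atTop atTop :=
      key 0 1 0 1 (-2) 0 (by push_cast; linarith) (fun L => by ring)
    have hM : Tendsto (fun L => N L + (2 * X L - S L - t L)) atTop atTop :=
      key 0 (-1) 1 (-1) 2 0 (by push_cast; linarith) (fun L => by ring)
    filter_upwards [hU.eventually_ge_atTop 0, hM.eventually_ge_atTop 0] with L hL₁ hL₂
    rw [abs_of_nonpos (by linarith)]
    linarith
  · intro h
    have lim := ((((upperLim (by linarith)).const_mul (q ^ (2 + 4 * Δx))).mul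
      (lowerLim (by linarith))).mul hexLim).div_const (denomFactor q c (2 * Δx))
    refine squared inf_le_left (by positivity) (f := fun L => q ^ (2 + 4 * Δx) *
      upperFactor q c (T L) (S L) (t L) (X L + Δx) *
      lowerFactor q c (S L) (N L) (t L) (X L + Δx) *
      hexFactor q (T L) (S L) (N L) (t L) (X L + Δx) / denomFactor q c (2 * Δx)) ?_ ?_
    · convert lim.mono_left inf_le_left using 2
      have e' : (2 + 4 * Δx) = (4 * Δx + 1) + 1 := by ring
      rw [div_pow, mul_pow, rpow_two_mul_add_half_sq hq0, mul_pow, Real.sq_sqrt (by positivity),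
        e', zpow_add_one₀ hq0.ne' (4 * Δx + 1), zpow_sub_one₀ hq0.ne', denomFactor]
      field_simp
    · filter_upwards [mem_inf_of_right (mem_principal_self _),
        mem_inf_of_left (kN.eventually_ge_atTop 0)] with L hL hL₀
      have hL' : 2 * X L = S L + t L := hL
      have e₁ : 2 * X L - S L - t L = 0 := by linarith
      have e₂ : 2 * (X L + Δx) - S L - t L = 2 * Δx := by linarith
      have e₃ : 2 * N L - 2 * N L + 2 + 2 * (2 * Δx) = 2 + 4 * Δx := by ring
      rw [e₁, e₂, abs_zero, sub_zero, max_eq_left hL₀, e₃]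
  · intro h₁ h₂
    refine rightHalf le_rfl h₁ h₂.le ?_
    have hU : Tendsto (fun L => 2 * X L - S L - t L) atTop atTop :=
      key 0 (-1) 0 (-1) 2 0 (by push_cast; linarith) (fun L => by ring)
    have hM : Tendsto (fun L => N L - (2 * X L - S L - t L)) atTop atTop :=
      key 0 1 1 1 (-2) 0 (by push_cast; linarith) (fun L => by ring)
    filter_upwards [hU.eventually_ge_atTop 0, hM.eventually_ge_atTop 0] with L hL₁ hL₂
    rwa [abs_of_nonneg hL₁]
  · intro h
    refine rightHalf inf_le_left (by linarith) h.le ?_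
    filter_upwards [mem_inf_of_right (mem_principal_self _),
      mem_inf_of_left (kN.eventually_ge_atTop 0)] with L hL hL₀
    have hL' : 2 * X L = S L + t L + N L := hL
    rw [abs_of_nonneg (by linarith)]
    linarith
  · intro h
    have hu : Tendsto (fun L => 2 * (X L + Δx) - S L - t L) atTop atTop :=
      key 0 (-1) 0 (-1) 2 (2 * Δx) (by push_cast; linarith) (fun L => by ring)
    have hU : Tendsto (fun L => (2 * X L - S L - t L) - N L) atTop atTop :=
      key 0 (-1) (-1) (-1) 2 0 (by push_cast; linarith) (fun L => by ring)
    have small := tendsto_zpow_mul_upperFactor (c := c) hq0 hq1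
      (k := fun L => 2 * 0 - 2 * N L + 2 + 2 * (2 * (X L + Δx) - S L - t L))
      (T := T) (S := S) (t := t) (x := fun L => X L + Δx)
      (key 0 (-2) (-2) (-2) 4 (2 + 4 * Δx) (by push_cast; linarith) (fun L => by ring))
      (key 1 (-2) (-2) (-2) 3 (2 + 3 * Δx) (by push_cast; linarith) (fun L => by ring))
      (key 0 (-1) (-2) (-1) 3 (2 + 3 * Δx) (by push_cast; linarith) (fun L => by ring))
      (key 1 (-1) (-2) (-1) 2 (2 + 2 * Δx) (by push_cast; linarith) (fun L => by ring))
    have lim := ((small.mul (lowerLim (by linarith))).mul hexLim).div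
      (tendsto_denomFactor (c := c) hq0 hq1 hu) hq0.ne'
    refine squared le_rfl le_rfl
      (by simpa only [zero_mul, zero_div, zero_pow two_ne_zero] using lim) ?_
    filter_upwards [hU.eventually_ge_atTop 0, kN.eventually_ge_atTop 0] with L hL₁ hL₂
    rw [Pi.div_apply, abs_of_nonneg (by linarith), max_eq_right (by linarith)]
end

section
/- Let q∈(0,1) and c>0, and set 𝐤 = log c / log q. There exists a constant c₂∈(0,1), depending only on q and c, such that for all positive integers T,S,N with S<T, every t∈{0,…,T}, and all pairwise distinct points x,y,z_1,…,z_{N−1} on the t-th vertical slice: c₂ < q^{−2Σ_{i=1}^{N−1}𝒢_𝐤(x,y,z_i|S+t)}·∏_{i=1}^{N−1} ( (1−q^{z_i−x})(1+c·q^{z_i−S−t+x+1}) / ((1−q^{z_i−y})(1+c·q^{z_i−S−t+y+1})) )² < c₂^{−1}. -/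
/-- `𝒢_𝐤(x,y,z|A) = (z−x)⁻ + (z−A+x+𝐤+1)⁻ − (z−y)⁻ − (z−A+y+𝐤+1)⁻`, where `a⁻ = min(a,0)`. -/
noncomputable def Gfun (k : ℝ) (x y z A : ℤ) : ℝ :=
  min ((z : ℝ) - x) 0 + min ((z : ℝ) - A + x + k + 1) 0
    - min ((z : ℝ) - y) 0 - min ((z : ℝ) - A + y + k + 1) 0

/-- `x` lies on the `t`-th vertical slice of the hexagon:
`max(0, t+S−T) ≤ x ≤ min(t+N−1, S+N−1)`. -/
def onSlice (T S N t x : ℤ) : Prop :=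
  max 0 (t + S - T) ≤ x ∧ x ≤ min (t + N - 1) (S + N - 1)

/-- `log |1 - q^m|` is `min(m, 0) log q` up to an error decaying geometrically in `|m|`. -/
lemma abs_log_one_sub_zpow_le {q : ℝ} (hq : q ∈ Set.Ioo (0 : ℝ) 1) {m : ℤ} (hm : m ≠ 0) :
    |Real.log (1 - q ^ m) - min (m : ℝ) 0 * Real.log q| ≤ (1 - q)⁻¹ * q ^ m.natAbs := by
  obtain ⟨h0, h1⟩ := hq
  obtain ⟨n, hn⟩ : ∃ n, m.natAbs = n := ⟨_, rfl⟩
  have hn0 : n ≠ 0 := by omega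
  have hu0 : 0 < q ^ n := pow_pos h0 n
  have huq : q ^ n ≤ q := pow_le_of_le_one h0.le h1.le hn0
  have hpos : 0 < 1 - q ^ n := by linarith
  have key : Real.log (1 - q ^ m) - min (m : ℝ) 0 * Real.log q = Real.log (1 - q ^ n) := by
    rcases Int.natAbs_eq m with h | h
    · rw [hn] at h
      subst h
      simp
    · rw [hn] at h
      subst h
      have hmin : min (((-(n : ℤ) : ℤ)) : ℝ) 0 = -(n : ℝ) := by simp
      have hfac : 1 - q ^ (-(n : ℤ)) = -((1 - q ^ n) / q ^ n) := by
        rw [zpow_neg, zpow_natCast]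
        field_simp
        ring
      rw [hmin, hfac, Real.log_neg_eq_log, Real.log_div hpos.ne' hu0.ne', Real.log_pow]
      ring
  rw [key, hn, abs_of_nonpos (Real.log_nonpos hpos.le (by linarith))]
  have hlog := Real.one_sub_inv_le_log_of_pos hpos
  have hinv : (1 - q ^ n)⁻¹ - 1 = (1 - q ^ n)⁻¹ * q ^ n := by
    field_simp
    ring
  have hle : (1 - q ^ n)⁻¹ ≤ (1 - q)⁻¹ := inv_anti₀ (by linarith) (by linarith)
  have := mul_le_mul_of_nonneg_right hle hu0.le
  linarith

/-- `log (1 + q^u)` is `min(u, 0) log q` up to an error at most `q^|u|`. -/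
lemma abs_log_one_add_rpow_le {q : ℝ} (h0 : 0 < q) (u : ℝ) :
    |Real.log (1 + q ^ u) - min u 0 * Real.log q| ≤ q ^ |u| := by
  have hpos : 0 < q ^ |u| := Real.rpow_pos_of_pos h0 _
  have key : Real.log (1 + q ^ u) - min u 0 * Real.log q = Real.log (1 + q ^ |u|) := by
    rcases le_total 0 u with h | h
    · simp [abs_of_nonneg h, min_eq_right h]
    · have hu : 0 < q ^ u := Real.rpow_pos_of_pos h0 _
      have hfac : 1 + q ^ (-u) = (1 + q ^ u) / q ^ u := by
        rw [Real.rpow_neg h0.le]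
        field_simp
        ring
      rw [abs_of_nonpos h, min_eq_left h, hfac, Real.log_div (by positivity) hu.ne',
        Real.log_rpow h0]
  rw [key, abs_of_nonneg (Real.log_nonneg (by linarith))]
  have := Real.log_le_sub_one_of_pos (show 0 < 1 + q ^ |u| by linarith)
  linarith

lemma abs_log_one_add_mul_zpow_le {q c k : ℝ} (hq : q ∈ Set.Ioo (0 : ℝ) 1) (hk : q ^ k = c)
    (n : ℤ) :
    |Real.log (1 + c * q ^ n) - min ((n : ℝ) + k) 0 * Real.log q| ≤
      q ^ (-|k|) * q ^ n.natAbs := by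
  obtain ⟨h0, h1⟩ := hq
  have hcq : c * q ^ n = q ^ ((n : ℝ) + k) := by
    rw [Real.rpow_add h0, hk, Real.rpow_intCast, mul_comm]
  rw [hcq]
  refine (abs_log_one_add_rpow_le h0 _).trans ?_
  rw [← Real.rpow_natCast, ← Real.rpow_add h0]
  apply Real.rpow_le_rpow_of_exponent_ge h0 h1.le
  have habs : ((n.natAbs : ℕ) : ℝ) = |(n : ℝ)| := by simp [Nat.cast_natAbs]
  have := abs_sub_abs_le_abs_sub (n : ℝ) (-k)
  rw [abs_neg, sub_neg_eq_add] at this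
  rw [habs]
  linarith

lemma summable_pow_natAbs {q : ℝ} (hq : q ∈ Set.Ioo (0 : ℝ) 1) :
    Summable fun m : ℤ => q ^ m.natAbs := by
  have h := summable_geometric_of_lt_one hq.1.le hq.2
  exact Summable.of_nat_of_neg (by simpa using h) (by simpa using h)

/-- Distinct integers contribute at most the full two-sided geometric series. -/
lemma sum_pow_natAbs_le_tsum {q : ℝ} (hq : q ∈ Set.Ioo (0 : ℝ) 1) {ι : Type*} [Fintype ι]
    {w : ι → ℤ} (hw : Function.Injective w) :
    ∑ i, q ^ (w i).natAbs ≤ ∑' m : ℤ, q ^ m.natAbs := by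
  have h := (summable_pow_natAbs hq).sum_le_tsum (Finset.univ.map ⟨w, hw⟩)
    (fun m _ => pow_nonneg hq.1.le _)
  simpa using h

/-- uniform multiplicative bounds for the interaction product.
There is a constant `c₂ ∈ (0,1)` depending only on `q, c` such that for all hexagons and
pairwise distinct points `x, y, z_1, …, z_{N−1}` on the `t`-th slice,
`c₂ < q^{−2Σ_i 𝒢_𝐤(x,y,z_i|S+t)} ∏_i ((1−q^{z_i−x})(1+cq^{z_i−S−t+x+1}) /
((1−q^{z_i−y})(1+cq^{z_i−S−t+y+1})))² < c₂⁻¹`. -/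
theorem interaction_ratio_bounds (q c : ℝ) (hq : q ∈ Set.Ioo (0:ℝ) 1) (hc : 0 < c)
    (k : ℝ) (hk : k = Real.log c / Real.log q) :
    ∃ c₂ : ℝ, 0 < c₂ ∧ c₂ < 1 ∧
      ∀ T S N t x y : ℤ, 0 < T → 0 < S → 0 < N → S < T → 0 ≤ t → t ≤ T →
        ∀ z : Fin (N - 1).toNat → ℤ,
        onSlice T S N t x → onSlice T S N t y → (∀ i, onSlice T S N t (z i)) →
        x ≠ y → (∀ i, z i ≠ x) → (∀ i, z i ≠ y) → Function.Injective z →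
        c₂ < q ^ (-2 * ∑ i, Gfun k x y (z i) (S + t)) *
              ∏ i, ((1 - q ^ (z i - x)) * (1 + c * q ^ (z i - S - t + x + 1)) /
                ((1 - q ^ (z i - y)) * (1 + c * q ^ (z i - S - t + y + 1)))) ^ 2 ∧
          q ^ (-2 * ∑ i, Gfun k x y (z i) (S + t)) *
              ∏ i, ((1 - q ^ (z i - x)) * (1 + c * q ^ (z i - S - t + x + 1)) /
                ((1 - q ^ (z i - y)) * (1 + c * q ^ (z i - S - t + y + 1)))) ^ 2
            < c₂⁻¹ := by
  obtain ⟨h0, h1⟩ := id hq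
  have hlogq : Real.log q < 0 := Real.log_neg h0 h1
  have hqk : q ^ k = c := by
    rw [Real.rpow_def_of_pos h0, hk, mul_div_cancel₀ _ hlogq.ne, Real.exp_log hc]
  set L : ℝ := ∑' m : ℤ, q ^ m.natAbs with hL
  have hL0 : 0 ≤ L := tsum_nonneg fun m => pow_nonneg h0.le _
  have hD : 0 < (1 - q)⁻¹ := inv_pos.2 (by linarith)
  have hK : 0 < q ^ (-|k|) := Real.rpow_pos_of_pos h0 _
  set B : ℝ := 4 * (1 - q)⁻¹ * L + 4 * q ^ (-|k|) * L with hB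
  have hB0 : 0 ≤ B := by positivity
  refine ⟨Real.exp (-(B + 1)), Real.exp_pos _, Real.exp_lt_one_iff.2 (by linarith), ?_⟩
  intro T S N t x y _ _ _ _ _ _ z _ _ _ _ hzx hzy hz
  rw [← Real.exp_neg, neg_neg]
  have hsub : ∀ m : ℤ, m ≠ 0 → 1 - q ^ m ≠ 0 := fun m hm h =>
    hm ((zpow_eq_one_iff_right₀ h0.le h1.ne).1 (by linarith))
  have hadd : ∀ m : ℤ, 1 + c * q ^ m ≠ 0 := fun m => by positivity
  have hx : ∀ i, 1 - q ^ (z i - x) ≠ 0 := fun i => hsub _ (sub_ne_zero.2 (hzx i))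
  have hy : ∀ i, 1 - q ^ (z i - y) ≠ 0 := fun i => hsub _ (sub_ne_zero.2 (hzy i))
  have hratio : ∀ i, ((1 - q ^ (z i - x)) * (1 + c * q ^ (z i - S - t + x + 1)) /
      ((1 - q ^ (z i - y)) * (1 + c * q ^ (z i - S - t + y + 1)))) ≠ 0 := fun i =>
    div_ne_zero (mul_ne_zero (hx i) (hadd _)) (mul_ne_zero (hy i) (hadd _))
  have hprod : 0 < ∏ i, ((1 - q ^ (z i - x)) * (1 + c * q ^ (z i - S - t + x + 1)) /
      ((1 - q ^ (z i - y)) * (1 + c * q ^ (z i - S - t + y + 1)))) ^ 2 :=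
    Finset.prod_pos fun i _ => sq_pos_of_ne_zero (hratio i)
  have hpow : 0 < q ^ (-2 * ∑ i, Gfun k x y (z i) (S + t)) := Real.rpow_pos_of_pos h0 _
  rw [← Real.lt_log_iff_exp_lt (mul_pos hpow hprod), ← Real.log_lt_iff_lt_exp (mul_pos hpow hprod),
    ← abs_lt, Real.log_mul hpow.ne' hprod.ne', Real.log_rpow h0,
    Real.log_prod fun i _ => pow_ne_zero 2 (hratio i), Finset.mul_sum, Finset.sum_mul,
    ← Finset.sum_add_distrib]
  refine lt_of_le_of_lt (b := B) ?_ (by linarith)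
  refine (Finset.abs_sum_le_sum_abs _ _).trans ?_
  have hterm : ∀ i, |-2 * Gfun k x y (z i) (S + t) * Real.log q +
      Real.log (((1 - q ^ (z i - x)) * (1 + c * q ^ (z i - S - t + x + 1)) /
        ((1 - q ^ (z i - y)) * (1 + c * q ^ (z i - S - t + y + 1)))) ^ 2)| ≤
      2 * ((1 - q)⁻¹ * q ^ (z i - x).natAbs + (1 - q)⁻¹ * q ^ (z i - y).natAbs +
        q ^ (-|k|) * q ^ (z i - S - t + x + 1).natAbs +
        q ^ (-|k|) * q ^ (z i - S - t + y + 1).natAbs) := by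
    intro i
    have ex := abs_le.1 (abs_log_one_sub_zpow_le hq (sub_ne_zero.2 (hzx i)))
    have ey := abs_le.1 (abs_log_one_sub_zpow_le hq (sub_ne_zero.2 (hzy i)))
    have fx := abs_le.1 (abs_log_one_add_mul_zpow_le hq hqk (z i - S - t + x + 1))
    have fy := abs_le.1 (abs_log_one_add_mul_zpow_le hq hqk (z i - S - t + y + 1))
    have ax : ((z i - S - t + x + 1 : ℤ) : ℝ) + k = (z i : ℝ) - (S + t : ℤ) + x + k + 1 := by
      push_cast; ring
    have ay : ((z i - S - t + y + 1 : ℤ) : ℝ) + k = (z i : ℝ) - (S + t : ℤ) + y + k + 1 := by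
      push_cast; ring
    rw [ax] at fx
    rw [ay] at fy
    rw [Int.cast_sub] at ex ey
    rw [Real.log_pow, Real.log_div (mul_ne_zero (hx i) (hadd _)) (mul_ne_zero (hy i) (hadd _)),
      Real.log_mul (hx i) (hadd _), Real.log_mul (hy i) (hadd _), Gfun, abs_le]
    push_cast at *
    constructor <;> linarith [ex.1, ex.2, ey.1, ey.2, fx.1, fx.2, fy.1, fy.2]
  refine (Finset.sum_le_sum fun i _ => hterm i).trans ?_
  have hinj : ∀ f : ℤ → ℤ, Function.Injective f → ∑ i, q ^ (f (z i)).natAbs ≤ L := fun f hf =>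
    sum_pow_natAbs_le_tsum hq (hf.comp hz)
  have sx := hinj (fun a => a - x) fun a b h => by simpa using h
  have sy := hinj (fun a => a - y) fun a b h => by simpa using h
  have rx := hinj (fun a => a - S - t + x + 1) fun a b h => by simpa using h
  have ry := hinj (fun a => a - S - t + y + 1) fun a b h => by simpa using h
  rw [← Finset.mul_sum]
  simp only [Finset.sum_add_distrib, ← Finset.mul_sum]
  have := mul_le_mul_of_nonneg_left sx hD.le
  have := mul_le_mul_of_nonneg_left sy hD.le
  have := mul_le_mul_of_nonneg_left rx hK.le
  have := mul_le_mul_of_nonneg_left ry hK.le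
  linarith
end

section
/- Let q∈(0,1) and α,β>0. Then, as the positive integer L tends to infinity: (i) lim_{L→∞} (αq^L;q)_∞/(βq^L;q)_∞ = 1; and (ii) lim_{L→∞} (β/α)^L·(−αq^{−L};q)_∞/(−βq^{−L};q)_∞ = θ_q(−α)/θ_q(−β). -/
open Filter

/-- The infinite q-Pochhammer symbol `(a; q)_∞ = ∏_{j=0}^∞ (1 - a q^j)`. -/
noncomputable def qPochInf (q a : ℝ) : ℝ := ∏' j : ℕ, (1 - a * q ^ j)

/-- The Jacobi theta function `θ_q(z) = (z; q)_∞ (q/z; q)_∞`. -/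
noncomputable def jtheta (q z : ℝ) : ℝ := qPochInf q z * qPochInf q (q / z)

section qPochInf

variable {q : ℝ}

theorem summable_norm_neg_mul_pow (hq : q ∈ Set.Ioo (0 : ℝ) 1) (a : ℝ) :
    Summable fun j : ℕ => ‖-(a * q ^ j)‖ :=
  ((summable_geometric_of_lt_one hq.1.le hq.2).mul_left a).neg.norm

theorem multipliable_one_sub_mul_pow (hq : q ∈ Set.Ioo (0 : ℝ) 1) (a : ℝ) :
    Multipliable fun j : ℕ => 1 - a * q ^ j := by
  simpa only [sub_eq_add_neg] using
    multipliable_one_add_of_summable (summable_norm_neg_mul_pow hq a)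

theorem tendsto_prod_range_qPochInf (hq : q ∈ Set.Ioo (0 : ℝ) 1) (a : ℝ) :
    Tendsto (fun n : ℕ => ∏ j ∈ Finset.range n, (1 - a * q ^ j)) atTop (nhds (qPochInf q a)) :=
  (multipliable_one_sub_mul_pow hq a).hasProd.tendsto_prod_nat

theorem qPochInf_eq_one_sub_mul (hq : q ∈ Set.Ioo (0 : ℝ) 1) (a : ℝ) :
    qPochInf q a = (1 - a) * qPochInf q (a * q) := by
  have h (j : ℕ) : 1 - a * q * q ^ j = 1 - a * q ^ (j + 1) := by ring
  have hm := multipliable_one_sub_mul_pow hq (a * q)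
  unfold qPochInf
  simp only [h] at hm ⊢
  rw [tprod_eq_zero_mul' (f := fun j : ℕ => 1 - a * q ^ j) hm, pow_zero, mul_one]

theorem qPochInf_ne_zero_of_nonpos (hq : q ∈ Set.Ioo (0 : ℝ) 1) {a : ℝ} (ha : a ≤ 0) :
    qPochInf q a ≠ 0 := by
  have h := tprod_one_add_ne_zero_of_summable (f := fun j : ℕ => -(a * q ^ j))
    (fun j => by
      have := mul_nonpos_of_nonpos_of_nonneg ha (pow_pos hq.1 j).le
      linarith) (summable_norm_neg_mul_pow hq a)
  simpa only [qPochInf, sub_eq_add_neg] using h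

theorem tendsto_qPochInf_mul_pow (hq : q ∈ Set.Ioo (0 : ℝ) 1) (a : ℝ) :
    Tendsto (fun L : ℕ => qPochInf q (a * q ^ L)) atTop (nhds 1) := by
  have h := tendsto_tprod_one_add_of_dominated_convergence (𝓕 := atTop)
    (f := fun L j : ℕ => -(a * q ^ L * q ^ j)) (g := fun _ => 0)
    (summable_norm_neg_mul_pow hq a)
    (fun j => by
      simpa using (((tendsto_pow_atTop_nhds_zero_of_lt_one hq.1.le hq.2).const_mul a).mul_const
        (q ^ j)).neg)
    (Eventually.of_forall fun L j => by
      rw [mul_right_comm, norm_neg, norm_neg, norm_mul _ (q ^ L)]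
      refine mul_le_of_le_one_right (norm_nonneg _) ?_
      rw [Real.norm_of_nonneg (pow_pos hq.1 L).le]
      exact pow_le_one₀ hq.1.le hq.2.le)
  simpa only [qPochInf, sub_eq_add_neg, add_zero, tprod_one] using h

/-- Splitting off the first `L` factors of `(a q^{-L}; q)_∞` and reversing their order. -/
theorem qPochInf_mul_zpow_neg (hq : q ∈ Set.Ioo (0 : ℝ) 1) {a : ℝ} (ha : a ≠ 0) (L : ℕ) :
    qPochInf q (a * q ^ (-(L : ℤ))) =
      (-a) ^ L * (∏ j ∈ Finset.range L, (q ^ (j + 1))⁻¹) *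
        (∏ j ∈ Finset.range L, (1 - q / a * q ^ j)) * qPochInf q a := by
  have hq0 : q ≠ 0 := hq.1.ne'
  induction L with
  | zero => simp
  | succ L ih =>
    have hshift : a * q ^ (-((L + 1 : ℕ) : ℤ)) * q = a * q ^ (-(L : ℤ)) := by
      rw [mul_assoc, ← zpow_add_one₀ hq0]
      congr 2
      push_cast
      ring
    have hfactor : 1 - a * q ^ (-((L + 1 : ℕ) : ℤ)) =
        -a * (q ^ (L + 1))⁻¹ * (1 - q / a * q ^ L) := by
      rw [zpow_neg, zpow_natCast]
      field_simp
      ring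
    rw [qPochInf_eq_one_sub_mul hq, hshift, ih, hfactor, Finset.prod_range_succ,
      Finset.prod_range_succ]
    ring

end qPochInf

/-- Let `q ∈ (0,1)` and `α, β > 0`. Then, as the positive integer `L → ∞`:
(i) `(αq^L;q)_∞ / (βq^L;q)_∞ → 1`; and
(ii) `(β/α)^L (−αq^{−L};q)_∞ / (−βq^{−L};q)_∞ → θ_q(−α)/θ_q(−β)`. -/
theorem qPochhammer_ratio_limits (q α β : ℝ) (hq : q ∈ Set.Ioo (0:ℝ) 1)
    (hα : 0 < α) (hβ : 0 < β) :
    Tendsto (fun L : ℕ => qPochInf q (α * q ^ L) / qPochInf q (β * q ^ L))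
      atTop (nhds 1) ∧
    Tendsto (fun L : ℕ =>
        (β / α) ^ L * qPochInf q (-α * q ^ (-(L : ℤ))) / qPochInf q (-β * q ^ (-(L : ℤ))))
      atTop (nhds (jtheta q (-α) / jtheta q (-β))) := by
  refine ⟨?_, ?_⟩
  · simpa only [div_one, Pi.div_def] using
      (tendsto_qPochInf_mul_pow hq α).div (tendsto_qPochInf_mul_pow hq β) one_ne_zero
  · have hne : jtheta q (-β) ≠ 0 :=
      mul_ne_zero (qPochInf_ne_zero_of_nonpos hq (neg_nonpos.2 hβ.le))
        (qPochInf_ne_zero_of_nonpos hq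
          (div_nonpos_of_nonneg_of_nonpos hq.1.le (neg_nonpos.2 hβ.le)))
    have htheta (z : ℝ) : Tendsto (fun L : ℕ =>
        qPochInf q z * ∏ j ∈ Finset.range L, (1 - q / z * q ^ j)) atTop (nhds (jtheta q z)) :=
      (tendsto_prod_range_qPochInf hq (q / z)).const_mul _
    refine ((htheta (-α)).div (htheta (-β)) hne).congr fun L => ?_
    rw [Pi.div_apply]
    have hprod : ∏ j ∈ Finset.range L, (q ^ (j + 1))⁻¹ ≠ 0 :=
      Finset.prod_ne_zero_iff.2 fun j _ => inv_ne_zero (pow_ne_zero _ hq.1.ne')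
    have hαL : α ^ L ≠ 0 := pow_ne_zero _ hα.ne'
    have hβL : β ^ L ≠ 0 := pow_ne_zero _ hβ.ne'
    rw [qPochInf_mul_zpow_neg hq (neg_ne_zero.2 hα.ne'),
      qPochInf_mul_zpow_neg hq (neg_ne_zero.2 hβ.ne'), neg_neg, neg_neg, div_pow]
    generalize ∏ j ∈ Finset.range L, (q ^ (j + 1))⁻¹ = c at hprod ⊢
    rw [← mul_div_mul_left _ _ (mul_ne_zero hβL hprod)]
    congr 1
    · rw [div_mul_eq_mul_div, eq_div_iff hαL]
      ring
    · ring
end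

section
/- Let q∈(0,1), c>0, and fix t,x∈ℤ. For a positive integer L define A₁(L) = q^{−11L}(1−q^{3L+x})(1+cq^{3L+x})(q^{t+1}+cq^{2x})·(−cq^{1−5L+x};q)_∞ / ((q^x−q^{5L})(q^t+cq^{2x})·(−cq^{−5L+x};q)_∞), a₁(L) = (q^x−q^{5L})(q^{5L}+cq^x)/(q^{t+1}+cq^{2x}), A₀(L) = (q^{−3L−t+x}−1)(q^t+cq^{2x+1})·(−cq^{−3L−t+x};q)_∞ / ((1−q^{5L−t+x})(q^t+cq^{2x})(1+cq^{5L−t+x})·(−cq^{1−3L−t+x};q)_∞), and a₀(L) = (1−q^{5L−t+x})(1+cq^{5L−t+x})/(1+cq^{1−t+2x}). Then for all sufficiently large L the quantities A₁(L) and A₀(L) are positive, and lim_{L→∞} q^{3L}·√(A₁(L))·a₁(L) = q^{−t/2}·𝔞(x−t/2) and lim_{L→∞} q^{3L}·√(A₀(L))·a₀(L) = q^{−t/2}·𝔞(x−t/2+1/2), where for ξ∈½ℤ one sets 𝔞(ξ) = √( c·q^{2ξ−1} / ((1+c·q^{2ξ})(1+c·q^{2ξ−1})) ). -/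
open Filter

/-- `A₁(L)`: the squared weight ratio entering the first inter-slice coefficient. -/
noncomputable def A1 (q c : ℝ) (t x : ℤ) (L : ℕ) : ℝ :=
  q ^ (-11 * (L : ℤ)) * (1 - q ^ (3 * (L : ℤ) + x)) * (1 + c * q ^ (3 * (L : ℤ) + x)) *
      (q ^ (t + 1) + c * q ^ (2 * x)) * qPochInf q (-c * q ^ (1 - 5 * (L : ℤ) + x)) /
    ((q ^ x - q ^ (5 * (L : ℤ))) * (q ^ t + c * q ^ (2 * x)) *
      qPochInf q (-c * q ^ (-5 * (L : ℤ) + x)))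

/-- `a₁(L)`. -/
noncomputable def a1 (q c : ℝ) (t x : ℤ) (L : ℕ) : ℝ :=
  (q ^ x - q ^ (5 * (L : ℤ))) * (q ^ (5 * (L : ℤ)) + c * q ^ x) /
    (q ^ (t + 1) + c * q ^ (2 * x))

/-- `A₀(L)`: the squared weight ratio entering the second inter-slice coefficient. -/
noncomputable def A0 (q c : ℝ) (t x : ℤ) (L : ℕ) : ℝ :=
  (q ^ (-3 * (L : ℤ) - t + x) - 1) * (q ^ t + c * q ^ (2 * x + 1)) *
      qPochInf q (-c * q ^ (-3 * (L : ℤ) - t + x)) /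
    ((1 - q ^ (5 * (L : ℤ) - t + x)) * (q ^ t + c * q ^ (2 * x)) *
      (1 + c * q ^ (5 * (L : ℤ) - t + x)) * qPochInf q (-c * q ^ (1 - 3 * (L : ℤ) - t + x)))

/-- `a₀(L)`. -/
noncomputable def a0 (q c : ℝ) (t x : ℤ) (L : ℕ) : ℝ :=
  (1 - q ^ (5 * (L : ℤ) - t + x)) * (1 + c * q ^ (5 * (L : ℤ) - t + x)) /
    (1 + c * q ^ (1 - t + 2 * x))

/-- The limiting coefficient `𝔞(ξ) = √(c q^{2ξ−1}/((1+cq^{2ξ})(1+cq^{2ξ−1})))`. -/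
noncomputable def afrak (q c : ℝ) (ξ : ℝ) : ℝ :=
  Real.sqrt (c * q ^ (2 * ξ - 1) / ((1 + c * q ^ (2 * ξ)) * (1 + c * q ^ (2 * ξ - 1))))

lemma multipliable_qPochInf_factors {q : ℝ} (hq : q ∈ Set.Ioo (0:ℝ) 1) (a : ℝ) :
    Multipliable fun j : ℕ => 1 - a * q ^ j := by
  have hs : Summable fun j : ℕ => -(a * q ^ j) :=
    ((summable_geometric_of_lt_one hq.1.le hq.2).mul_left a).neg
  simpa [sub_eq_add_neg] using Real.multipliable_one_add_of_summable hs

lemma qPochInf_eq_mul {q : ℝ} (hq : q ∈ Set.Ioo (0:ℝ) 1) (a : ℝ) :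
    qPochInf q a = (1 - a) * qPochInf q (a * q) := by
  have h := (multipliable_qPochInf_factors hq (a * q))
  have e : (fun j : ℕ => 1 - a * q ^ (j + 1)) = fun j : ℕ => 1 - a * q * q ^ j := by
    funext j; ring
  unfold qPochInf
  rw [tprod_eq_zero_mul' (by rw [e]; exact h), e]
  simp

lemma qPochInf_pos {q : ℝ} (hq : q ∈ Set.Ioo (0:ℝ) 1) {a : ℝ} (ha : a ≤ 0) :
    0 < qPochInf q a := by
  have hs : Summable fun j : ℕ => -(a * q ^ j) :=
    ((summable_geometric_of_lt_one hq.1.le hq.2).mul_left a).neg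
  have hpos (j : ℕ) : 0 < 1 - a * q ^ j := by
    have := mul_nonneg (neg_nonneg.2 ha) (pow_pos hq.1 j).le
    linarith
  rw [qPochInf, ← Real.rexp_tsum_eq_tprod hpos
    (by simpa [sub_eq_add_neg] using Real.summable_log_one_add_of_summable hs)]
  exact Real.exp_pos _

/-- Clearing `q^{6L}` under the square root. -/
lemma eventually_pos_and_tendsto_of_rescaled {y A F a : ℕ → ℝ} {F₀ a₀ : ℝ}
    (hy : ∀ L, 0 < y L) (hA : ∀ L, A L = F L / y L ^ 6) (hF : Tendsto F atTop (nhds F₀))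
    (hF₀ : 0 < F₀) (ha : Tendsto a atTop (nhds a₀)) :
    (∀ᶠ L in atTop, 0 < A L) ∧
      Tendsto (fun L => y L ^ 3 * Real.sqrt (A L) * a L) atTop (nhds (Real.sqrt F₀ * a₀)) := by
  constructor
  · filter_upwards [hF.eventually_const_lt hF₀] with L hL
    rw [hA]
    exact div_pos hL (pow_pos (hy L) 6)
  · have e : (fun L => y L ^ 3 * Real.sqrt (A L) * a L) = fun L => Real.sqrt (F L) * a L := by
      funext L
      have h3 : (0:ℝ) < y L ^ 3 := pow_pos (hy L) 3
      rw [hA, show y L ^ 6 = (y L ^ 3) ^ 2 by ring, Real.sqrt_div' _ (sq_nonneg _),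
        Real.sqrt_sq h3.le, mul_div_cancel₀ _ h3.ne']
    rw [e]
    exact hF.sqrt.mul ha

lemma A1_eq {q c : ℝ} (hq : q ∈ Set.Ioo (0:ℝ) 1) (hc : 0 < c) (t x : ℤ) (L : ℕ) :
    A1 q c t x L =
      (1 - (q ^ L) ^ 3 * q ^ x) * (1 + c * ((q ^ L) ^ 3 * q ^ x)) *
        (q ^ t * q + c * (q ^ x) ^ 2) /
      ((q ^ x - (q ^ L) ^ 5) * (q ^ t + c * (q ^ x) ^ 2) * ((q ^ L) ^ 5 + c * q ^ x)) /
      (q ^ L) ^ 6 := by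
  have hq0 : q ≠ 0 := hq.1.ne'
  have hX : 0 < q ^ x := zpow_pos hq.1 x
  have hT : 0 < q ^ t := zpow_pos hq.1 t
  have hy : 0 < q ^ L := pow_pos hq.1 L
  have hP := qPochInf_eq_mul hq (-c * q ^ (-5 * (L : ℤ) + x))
  have e1 : -c * q ^ (-5 * (L : ℤ) + x) * q = -c * q ^ (1 - 5 * (L : ℤ) + x) := by
    rw [mul_assoc, ← zpow_add_one₀ hq0]; ring_nf
  have hpos : 0 < qPochInf q (-c * q ^ (1 - 5 * (L : ℤ) + x)) :=
    qPochInf_pos hq (by have := zpow_pos hq.1 (1 - 5 * (L : ℤ) + x); nlinarith)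
  have e5 : q ^ (-5 * (L : ℤ) + x) = q ^ x / (q ^ L) ^ 5 := by
    rw [zpow_add₀ hq0, mul_comm (-5 : ℤ), zpow_mul, zpow_natCast, zpow_neg, mul_comm,
      div_eq_mul_inv]; rfl
  have e3 : q ^ (3 * (L : ℤ) + x) = (q ^ L) ^ 3 * q ^ x := by
    rw [zpow_add₀ hq0, mul_comm (3 : ℤ), zpow_mul, zpow_natCast]; rfl
  have e55 : q ^ (5 * (L : ℤ)) = (q ^ L) ^ 5 := by
    rw [mul_comm (5 : ℤ), zpow_mul, zpow_natCast]; rfl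
  have e11 : q ^ (-11 * (L : ℤ)) = ((q ^ L) ^ 11)⁻¹ := by
    rw [mul_comm (-11 : ℤ), zpow_mul, zpow_natCast, zpow_neg]; rfl
  have e2 : q ^ (2 * x) = (q ^ x) ^ 2 := by
    rw [mul_comm, zpow_mul]; rfl
  rw [e1] at hP
  unfold A1
  rw [hP, e5, e3, e55, e11, e2, zpow_add_one₀ hq0]
  generalize qPochInf q (-c * q ^ (1 - 5 * (L : ℤ) + x)) = P at *
  generalize q ^ L = y at *
  generalize q ^ x = X at *
  generalize q ^ t = T at *
  have h1 : y ^ 5 + c * X ≠ 0 := by positivity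
  have h2 : T + c * X ^ 2 ≠ 0 := by positivity
  have h3 : 1 - -c * (X / y ^ 5) = (y ^ 5 + c * X) / y ^ 5 := by
    field_simp
    ring
  rw [h3]
  by_cases h4 : X - y ^ 5 = 0
  · simp [h4]
  · field_simp

lemma A0_eq {q c : ℝ} (hq : q ∈ Set.Ioo (0:ℝ) 1) (hc : 0 < c) (t x : ℤ) (L : ℕ) :
    A0 q c t x L =
      (q ^ (x - t) - (q ^ L) ^ 3) * (q ^ t + c * ((q ^ x) ^ 2 * q)) *
        ((q ^ L) ^ 3 + c * q ^ (x - t)) /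
      ((1 - (q ^ L) ^ 5 * q ^ (x - t)) * (q ^ t + c * (q ^ x) ^ 2) *
        (1 + c * ((q ^ L) ^ 5 * q ^ (x - t)))) /
      (q ^ L) ^ 6 := by
  have hq0 : q ≠ 0 := hq.1.ne'
  have hX : 0 < q ^ x := zpow_pos hq.1 x
  have hD : 0 < q ^ (x - t) := zpow_pos hq.1 _
  have hT : 0 < q ^ t := zpow_pos hq.1 t
  have hy : 0 < q ^ L := pow_pos hq.1 L
  have hP := qPochInf_eq_mul hq (-c * q ^ (-3 * (L : ℤ) - t + x))
  have e1 : -c * q ^ (-3 * (L : ℤ) - t + x) * q = -c * q ^ (1 - 3 * (L : ℤ) - t + x) := by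
    rw [mul_assoc, ← zpow_add_one₀ hq0]; ring_nf
  have hpos : 0 < qPochInf q (-c * q ^ (1 - 3 * (L : ℤ) - t + x)) :=
    qPochInf_pos hq (by have := zpow_pos hq.1 (1 - 3 * (L : ℤ) - t + x); nlinarith)
  have e3 : q ^ (-3 * (L : ℤ) - t + x) = q ^ (x - t) / (q ^ L) ^ 3 := by
    rw [show -3 * (L : ℤ) - t + x = L * (-3) + (x - t) by ring, zpow_add₀ hq0, zpow_mul,
      zpow_natCast, zpow_neg, mul_comm, div_eq_mul_inv]; rfl
  have e5 : q ^ (5 * (L : ℤ) - t + x) = (q ^ L) ^ 5 * q ^ (x - t) := by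
    rw [show 5 * (L : ℤ) - t + x = L * 5 + (x - t) by ring, zpow_add₀ hq0, zpow_mul,
      zpow_natCast]; rfl
  have e2 : q ^ (2 * x) = (q ^ x) ^ 2 := by
    rw [mul_comm, zpow_mul]; rfl
  rw [e1] at hP
  unfold A0
  rw [hP, e5, e3, zpow_add_one₀ hq0, e2]
  generalize qPochInf q (-c * q ^ (1 - 3 * (L : ℤ) - t + x)) = P at *
  generalize q ^ L = y at *
  generalize q ^ (x - t) = D at *
  generalize q ^ x = X at *
  generalize q ^ t = T at *
  have h1 : 1 + c * (y ^ 5 * D) ≠ 0 := by positivity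
  have h2 : T + c * X ^ 2 ≠ 0 := by positivity
  by_cases h4 : 1 - y ^ 5 * D = 0
  · simp [h4]
  · field_simp
    ring

lemma tendsto_rescaled_A1 {q c : ℝ} (hq : q ∈ Set.Ioo (0:ℝ) 1) (hc : 0 < c) (t x : ℤ) :
    (∀ᶠ L : ℕ in atTop, 0 < A1 q c t x L) ∧
    Tendsto (fun L : ℕ => q ^ (3 * (L : ℤ)) * Real.sqrt (A1 q c t x L) * a1 q c t x L) atTop
      (nhds (Real.sqrt ((q ^ t * q + c * (q ^ x) ^ 2) /
        (q ^ x * (q ^ t + c * (q ^ x) ^ 2) * (c * q ^ x))) *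
        (q ^ x * (c * q ^ x) / (q ^ t * q + c * (q ^ x) ^ 2)))) := by
  have hq0 : q ≠ 0 := hq.1.ne'
  have hX : 0 < q ^ x := zpow_pos hq.1 x
  have hT : 0 < q ^ t := zpow_pos hq.1 t
  have hq1 := hq.1
  have hy : Tendsto (fun L : ℕ => q ^ L) atTop (nhds 0) :=
    tendsto_pow_atTop_nhds_zero_of_lt_one hq.1.le hq.2
  have e (L : ℕ) : q ^ (3 * (L : ℤ)) = (q ^ L) ^ 3 := by
    rw [mul_comm (3 : ℤ), zpow_mul, zpow_natCast]; rfl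
  have e5 (L : ℕ) : q ^ (5 * (L : ℤ)) = (q ^ L) ^ 5 := by
    rw [mul_comm (5 : ℤ), zpow_mul, zpow_natCast]; rfl
  have e2 : q ^ (2 * x) = (q ^ x) ^ 2 := by
    rw [mul_comm, zpow_mul]; rfl
  simp only [e]
  refine eventually_pos_and_tendsto_of_rescaled (fun L => pow_pos hq.1 L)
    (A1_eq hq hc t x) ?_ (by positivity) ?_
  · have hcont : ContinuousAt (fun y : ℝ => (1 - y ^ 3 * q ^ x) * (1 + c * (y ^ 3 * q ^ x)) *
        (q ^ t * q + c * (q ^ x) ^ 2) /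
      ((q ^ x - y ^ 5) * (q ^ t + c * (q ^ x) ^ 2) * (y ^ 5 + c * q ^ x))) 0 := by
      refine ContinuousAt.div (by fun_prop) (by fun_prop) ?_
      simp only [ne_eq, OfNat.ofNat_ne_zero, not_false_eq_true, zero_pow, sub_zero, zero_add]
      positivity
    simpa [Function.comp_def] using hcont.tendsto.comp hy
  · change Tendsto (fun L : ℕ => a1 q c t x L) atTop _
    simp only [a1, e5, e2, zpow_add_one₀ hq0]
    have hcont : Continuous (fun y : ℝ => (q ^ x - y ^ 5) * (y ^ 5 + c * q ^ x) /
        (q ^ t * q + c * (q ^ x) ^ 2)) := by fun_prop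
    simpa [Function.comp_def] using (hcont.tendsto 0).comp hy

lemma tendsto_rescaled_A0 {q c : ℝ} (hq : q ∈ Set.Ioo (0:ℝ) 1) (hc : 0 < c) (t x : ℤ) :
    (∀ᶠ L : ℕ in atTop, 0 < A0 q c t x L) ∧
    Tendsto (fun L : ℕ => q ^ (3 * (L : ℤ)) * Real.sqrt (A0 q c t x L) * a0 q c t x L) atTop
      (nhds (Real.sqrt (q ^ (x - t) * (q ^ t + c * ((q ^ x) ^ 2 * q)) * (c * q ^ (x - t)) /
        (q ^ t + c * (q ^ x) ^ 2)) * (1 + c * q ^ (1 - t + 2 * x))⁻¹)) := by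
  have hq0 : q ≠ 0 := hq.1.ne'
  have hX : 0 < q ^ x := zpow_pos hq.1 x
  have hD : 0 < q ^ (x - t) := zpow_pos hq.1 _
  have hT : 0 < q ^ t := zpow_pos hq.1 t
  have hq1 := hq.1
  have hy : Tendsto (fun L : ℕ => q ^ L) atTop (nhds 0) :=
    tendsto_pow_atTop_nhds_zero_of_lt_one hq.1.le hq.2
  have e (L : ℕ) : q ^ (3 * (L : ℤ)) = (q ^ L) ^ 3 := by
    rw [mul_comm (3 : ℤ), zpow_mul, zpow_natCast]; rfl
  have e5 (L : ℕ) : q ^ (5 * (L : ℤ) - t + x) = (q ^ L) ^ 5 * q ^ (x - t) := by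
    rw [show 5 * (L : ℤ) - t + x = L * 5 + (x - t) by ring, zpow_add₀ hq0, zpow_mul,
      zpow_natCast]; rfl
  simp only [e]
  refine eventually_pos_and_tendsto_of_rescaled (fun L => pow_pos hq.1 L)
    (A0_eq hq hc t x) ?_ (by positivity) ?_
  · have hcont : ContinuousAt (fun y : ℝ =>
      (q ^ (x - t) - y ^ 3) * (q ^ t + c * ((q ^ x) ^ 2 * q)) * (y ^ 3 + c * q ^ (x - t)) /
      ((1 - y ^ 5 * q ^ (x - t)) * (q ^ t + c * (q ^ x) ^ 2) *
        (1 + c * (y ^ 5 * q ^ (x - t))))) 0 := by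
      refine ContinuousAt.div (by fun_prop) (by fun_prop) ?_
      simp only [ne_eq, OfNat.ofNat_ne_zero, not_false_eq_true, zero_pow, sub_zero, zero_mul,
        mul_zero, add_zero, mul_one, one_mul]
      positivity
    simpa [Function.comp_def] using hcont.tendsto.comp hy
  · change Tendsto (fun L : ℕ => a0 q c t x L) atTop _
    simp only [a0, e5]
    have hcont : Continuous (fun y : ℝ => (1 - y ^ 5 * q ^ (x - t)) *
        (1 + c * (y ^ 5 * q ^ (x - t))) / (1 + c * q ^ (1 - t + 2 * x))) := by fun_prop
    simpa [Function.comp_def] using (hcont.tendsto 0).comp hy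

lemma rpow_neg_half_mul_sqrt {q : ℝ} (hq : 0 < q) (t : ℤ) (G : ℝ) :
    q ^ (-(t : ℝ) / 2) * Real.sqrt G = Real.sqrt ((q ^ t)⁻¹ * G) := by
  have hT : 0 < q ^ t := zpow_pos hq t
  rw [Real.sqrt_mul (inv_pos.2 hT).le, Real.sqrt_eq_rpow (q ^ t)⁻¹, ← zpow_neg,
    ← Real.rpow_intCast, ← Real.rpow_mul hq.le]
  congr 2
  push_cast
  ring

lemma sqrt_mul_eq_sqrt_mul_sq {F a : ℝ} (ha : 0 ≤ a) :
    Real.sqrt F * a = Real.sqrt (F * a ^ 2) := by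
  rw [Real.sqrt_mul' _ (sq_nonneg a), Real.sqrt_sq ha]

/-- fixed-`q` asymptotics of the inter-slice transition coefficients of the
q-Racah lozenge tiling ensemble of the hexagon with sides `T = 8L`, `N = S = 4L`. -/
theorem inter_slice_coefficient_limits (q c : ℝ) (hq : q ∈ Set.Ioo (0:ℝ) 1) (hc : 0 < c)
    (t x : ℤ) :
    (∀ᶠ L : ℕ in atTop, 0 < A1 q c t x L ∧ 0 < A0 q c t x L) ∧
    Tendsto (fun L : ℕ => q ^ (3 * (L : ℤ)) * Real.sqrt (A1 q c t x L) * a1 q c t x L)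
      atTop (nhds (q ^ (-(t : ℝ) / 2) * afrak q c ((x : ℝ) - (t : ℝ) / 2))) ∧
    Tendsto (fun L : ℕ => q ^ (3 * (L : ℤ)) * Real.sqrt (A0 q c t x L) * a0 q c t x L)
      atTop (nhds (q ^ (-(t : ℝ) / 2) * afrak q c ((x : ℝ) - (t : ℝ) / 2 + 1 / 2))) := by
  have hq1 := hq.1
  have hq0 : q ≠ 0 := hq1.ne'
  have hX : 0 < q ^ x := zpow_pos hq1 x
  have hT : 0 < q ^ t := zpow_pos hq1 t
  have hZ : q ^ (1 - t + 2 * x) = (q ^ x) ^ 2 * q / q ^ t := by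
    rw [show 1 - t + 2 * x = x + x + 1 - t by ring, zpow_sub₀ hq0, zpow_add_one₀ hq0,
      zpow_add₀ hq0, sq]
  have hD : q ^ (x - t) = q ^ x / q ^ t := zpow_sub₀ hq0 x t
  have r0 : q ^ (2 * ((x : ℝ) - (t : ℝ) / 2)) = (q ^ x) ^ 2 / q ^ t := by
    rw [show 2 * ((x : ℝ) - (t : ℝ) / 2) = ((x + x - t : ℤ) : ℝ) by push_cast; ring,
      Real.rpow_intCast, zpow_sub₀ hq0, zpow_add₀ hq0, sq]
  have r1 : q ^ (2 * ((x : ℝ) - (t : ℝ) / 2) - 1) = (q ^ x) ^ 2 / q ^ t / q := by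
    rw [Real.rpow_sub_one hq0, r0]
  have s0 : q ^ (2 * ((x : ℝ) - (t : ℝ) / 2 + 1 / 2)) = (q ^ x) ^ 2 / q ^ t * q := by
    rw [show 2 * ((x : ℝ) - (t : ℝ) / 2 + 1 / 2) = 2 * ((x : ℝ) - (t : ℝ) / 2) + 1 by ring,
      Real.rpow_add_one hq0, r0]
  have s1 : q ^ (2 * ((x : ℝ) - (t : ℝ) / 2 + 1 / 2) - 1) = (q ^ x) ^ 2 / q ^ t := by
    rw [Real.rpow_sub_one hq0, s0, mul_div_cancel_right₀ _ hq0]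
  obtain ⟨p1, l1⟩ := tendsto_rescaled_A1 hq hc t x
  obtain ⟨p0, l0⟩ := tendsto_rescaled_A0 hq hc t x
  refine ⟨p1.and p0, ?_, ?_⟩
  · convert l1 using 2
    rw [afrak, r0, r1, rpow_neg_half_mul_sqrt hq1, sqrt_mul_eq_sqrt_mul_sq (by positivity)]
    congr 1
    field_simp
  · convert l0 using 2
    rw [afrak, s0, s1, hZ, hD, rpow_neg_half_mul_sqrt hq1,
      sqrt_mul_eq_sqrt_mul_sq (by positivity)]
    congr 1
    field_simp
end
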